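/- arXiv:1704.07667 — 6 statements merged into one kernel-verified Lean document; each statement's English description precedes it below -/
import Mathlib

section
/- Let p be a prime with p ≡ 1 (mod 16) that admits representations p = x² + 16 = a² + 2b² with integers x, a, b satisfying x ≡ a ≡ 1 (mod 4) and x − a = 4. With the cyclotomic classes D_0, …, D_7 of order 8 modulo p, define the quaternary sequence u : ℤ/pℤ → ℤ/4ℤ by u(t) = 0 if t ∈ D_2 ∪ D_6 ∪ {0}, u(t) = 1 if t ∈ D_1 ∪ D_3, u(t) = 2 if t ∈ D_0 ∪ D_4, and u(t) = 3 if t ∈ D_5 ∪ D_7. Then R_u(0) = p, and for every τ ≢ 0 (mod p) the autocorrelation value R_u(τ) lies in {−1, −3, 3}. -/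
open scoped Classical

noncomputable section

/-- The cyclotomic class `D_k` of order `e` modulo `p`, with respect to the
primitive root `γ`: `D_k = {γ^(k+e*j) : 0 ≤ j < (p-1)/e}`. -/
def cycCl (p : ℕ) (γ : ZMod p) (e k : ℕ) : Set (ZMod p) :=
  {x | ∃ j : ℕ, j < (p - 1) / e ∧ x = γ ^ (k + e * j)}

/-- Periodic autocorrelation of a quaternary sequence `u : ℤ/N → ℤ/4` at shift `τ`:
`R_u(τ) = Σ_t i^(u(t) - u(t+τ))`. -/
def quatAC {N : ℕ} [NeZero N] (u : ZMod N → ZMod 4) (τ : ZMod N) : ℂ :=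
  ∑ t : ZMod N, Complex.I ^ (u t - u (t + τ)).val

/-- Periodic crosscorrelation of binary sequences `s₁ s₂ : ℤ/N → ℤ/2` at shift `τ`:
`R_{s₁,s₂}(τ) = Σ_t (-1)^(s₁(t) - s₂(t+τ))`. -/
def binCC {N : ℕ} [NeZero N] (s₁ s₂ : ZMod N → ZMod 2) (τ : ZMod N) : ℤ :=
  ∑ t : ZMod N, (-1 : ℤ) ^ (s₁ t - s₂ (t + τ)).val

/-- The inverse Gray map `φ⁻¹ : ℤ/2 × ℤ/2 → ℤ/4`,
`φ⁻¹(0,0)=0, φ⁻¹(0,1)=1, φ⁻¹(1,1)=2, φ⁻¹(1,0)=3`. -/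
def grayInv (a b : ZMod 2) : ZMod 4 :=
  if a = 0 then (if b = 0 then 0 else 1) else (if b = 0 then 3 else 2)

/-- Characteristic (binary) sequence of a subset `C ⊆ ℤ/p`. -/
def charSeq {p : ℕ} (C : Set (ZMod p)) (t : ZMod p) : ZMod 2 :=
  if t ∈ C then 1 else 0

/-- `N_k(u)`: the number of `t` with `u(t) = k`. -/
def cnt {N m : ℕ} (u : ZMod N → ZMod m) (k : ZMod m) : ℕ :=
  {t | u t = k}.ncard

section JacobiSums

variable {F : Type*} [Field F] [Fintype F]

/-- The substitution `t ↦ t / (t - 1)` in a Jacobi sum. -/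
lemma jacobiSum_eq_apply_neg_one_mul (α β : MulChar F ℂ) :
    jacobiSum α β = α (-1) * jacobiSum α (α * β)⁻¹ := by
  have hl : jacobiSum α β = ∑ t ∈ Finset.univ \ {(1 : F)}, α t * β (1 - t) := by
    rw [jacobiSum, Finset.sum_sdiff_eq_sub (Finset.subset_univ _)]
    simp [MulChar.map_zero]
  have hr : jacobiSum α (α * β)⁻¹ =
      ∑ t ∈ Finset.univ \ {(1 : F)}, α t * (α * β)⁻¹ (1 - t) := by
    rw [jacobiSum, Finset.sum_sdiff_eq_sub (Finset.subset_univ _)]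
    simp [MulChar.map_zero]
  rw [hl, hr, Finset.mul_sum]
  have hne : ∀ t ∈ Finset.univ \ {(1 : F)}, t - 1 ≠ 0 := by
    intro t ht
    simpa [sub_eq_zero] using ht
  have hinv : ∀ t : F, t - 1 ≠ 0 → t / (t - 1) / (t / (t - 1) - 1) = t := by
    intro t h
    have h1 : t / (t - 1) - 1 = 1 / (t - 1) := by field_simp; ring
    rw [h1]
    field_simp
  have hmem : ∀ t ∈ Finset.univ \ {(1 : F)}, t / (t - 1) ∈ Finset.univ \ {(1 : F)} := by
    intro t ht
    have h := hne t ht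
    simp only [Finset.mem_sdiff, Finset.mem_univ, Finset.mem_singleton, true_and]
    rw [div_eq_iff h]
    intro h'
    have : (1 : F) = 0 := by linear_combination h'
    exact one_ne_zero this
  refine Finset.sum_nbij' (fun t => t / (t - 1)) (fun t => t / (t - 1)) hmem hmem
    (fun t ht => hinv t (hne t ht)) (fun t ht => hinv t (hne t ht)) ?_
  intro t ht
  have h := hne t ht
  have h1 : 1 - t / (t - 1) = -(t - 1)⁻¹ := by field_simp; ring
  rw [h1, MulChar.inv_apply', MulChar.mul_apply, inv_neg, inv_inv]
  have h2 : α (-1) * (α (t / (t - 1)) * (α (-(t - 1)) * β (-(t - 1)))) =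
      α (-1 * (t / (t - 1)) * -(t - 1)) * β (-(t - 1)) := by
    simp only [map_mul]; ring
  rw [h2]
  congr 2
  · field_simp
  · ring

/-- Summation over squares. -/
lemma sum_comp_sq [DecidableEq F] (hF : ringChar F ≠ 2) {R : Type*} [CommRing R] (G : F → R) :
    ∑ s : F, G (s ^ 2) = ∑ t : F, (1 + (quadraticChar F t : R)) * G t := by
  rw [← Finset.sum_fiberwise (s := Finset.univ) (g := fun s : F => s ^ 2)]
  refine Finset.sum_congr rfl fun t _ => ?_
  rw [Finset.sum_congr rfl (g := fun _ => G t)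
    (fun s hs => by rw [(Finset.mem_filter.mp hs).2]), Finset.sum_const, nsmul_eq_mul]
  congr 1
  have h := quadraticChar_card_sqrts hF t
  have h2 : ({x : F | x ^ 2 = t}.toFinset) = Finset.univ.filter (fun s : F => s ^ 2 = t) := by
    ext; simp
  rw [h2] at h
  have := congrArg (Int.cast : ℤ → R) h
  push_cast at this
  rw [this, add_comm]

/-- The Jacobi sum of a nontrivial character with the quadratic character. -/
lemma jacobiSum_quadratic [DecidableEq F] (hF : ringChar F ≠ 2) (α η : MulChar F ℂ) (hα : α ≠ 1)
    (hη : ∀ t, η t = (quadraticChar F t : ℂ)) :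
    jacobiSum α η = ∑ s : F, α (1 - s ^ 2) := by
  have h0 : ∑ t : F, α (1 - t) = 0 := by
    rw [← MulChar.sum_eq_zero_of_ne_one hα]
    exact (Equiv.subLeft (1 : F)).sum_comp (fun t => α t)
  rw [sum_comp_sq hF (fun t => α (1 - t)), jacobiSum_comm, jacobiSum]
  simp only [add_mul, one_mul, Finset.sum_add_distrib, h0, zero_add, hη]

/-- The duplication formula for Jacobi sums. -/
lemma jacobiSum_self [DecidableEq F] (hF : ringChar F ≠ 2) (α η : MulChar F ℂ) (hα : α ≠ 1)
    (hη : ∀ t, η t = (quadraticChar F t : ℂ)) :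
    α 4 * jacobiSum α α = jacobiSum α η := by
  have h2 : (2 : F) ≠ 0 := Ring.two_ne_zero hF
  rw [jacobiSum_quadratic hF α η hα hη, jacobiSum, Finset.mul_sum]
  refine Fintype.sum_equiv ((Equiv.mulLeft₀ 2 h2).trans (Equiv.subRight 1)) _ _ fun t => ?_
  rw [← map_mul, ← map_mul]
  congr 1
  simp
  ring

/-- Shifted correlation of two characters in terms of a Jacobi sum. -/
lemma sum_mul_shift (α β : MulChar F ℂ) (hα : α (-1) = 1) {τ : F} (hτ : τ ≠ 0) :
    ∑ t : F, α t * β (t + τ) = α τ * β τ * jacobiSum α β := by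
  rw [jacobiSum, Finset.mul_sum]
  refine (Fintype.sum_equiv (Equiv.mulLeft₀ (-τ) (neg_ne_zero.mpr hτ)) _ _ fun t => ?_).symm
  have h1 : -τ * t = -1 * τ * t := by ring
  have h2 : -τ * t + τ = τ * (1 - t) := by ring
  simp only [Equiv.mulLeft₀_apply]
  rw [h2, h1, map_mul, map_mul, map_mul, hα]
  ring

/-- The cocycle relation for Jacobi sums. -/
lemma jacobiSum_mul_jacobiSum (hF : (Fintype.card F : ℂ) ≠ 0) (α β γ : MulChar F ℂ)
    (h1 : α * β ≠ 1) (h2 : β * γ ≠ 1) (h3 : α * β * γ ≠ 1) :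
    jacobiSum α β * jacobiSum (α * β) γ = jacobiSum β γ * jacobiSum α (β * γ) := by
  have hψ := AddChar.FiniteField.primitiveChar_to_Complex_isPrimitive F
  have h3' : α * (β * γ) ≠ 1 := by rwa [← mul_assoc]
  have g1 := gaussSum_ne_zero_of_nontrivial hF h1 hψ
  have g2 := gaussSum_ne_zero_of_nontrivial hF h2 hψ
  rw [jacobiSum_eq_gaussSum_mul_gaussSum_div_gaussSum hF h1 hψ,
    jacobiSum_eq_gaussSum_mul_gaussSum_div_gaussSum hF h2 hψ,
    jacobiSum_eq_gaussSum_mul_gaussSum_div_gaussSum hF h3 hψ,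
    jacobiSum_eq_gaussSum_mul_gaussSum_div_gaussSum hF h3' hψ, ← mul_assoc α β γ]
  field_simp

end JacobiSums

section Arithmetic

/-- Uniqueness of the representation of a prime by `X² + 2Y²`. -/
lemma sq_eq_of_prime_eq_sq_add_two_mul_sq {p : ℕ} (hp : p.Prime) {x y a b : ℤ}
    (h1 : (p : ℤ) = x ^ 2 + 2 * y ^ 2) (h2 : (p : ℤ) = a ^ 2 + 2 * b ^ 2) : x ^ 2 = a ^ 2 := by
  have hp' : Prime (p : ℤ) := Nat.prime_iff_prime_int.mp hp
  have hpos : (0 : ℤ) < p := by exact_mod_cast hp.pos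
  wlog hd : (p : ℤ) ∣ x * b - y * a generalizing b
  · have hm : (p : ℤ) ∣ (x * b - y * a) * (x * b + y * a) :=
      ⟨b ^ 2 - y ^ 2, by linear_combination (-b ^ 2) * h1 + y ^ 2 * h2⟩
    rcases hp'.dvd_or_dvd hm with h | h
    · exact absurd h hd
    · exact this (b := -b) (by rw [h2]; ring) (by
        obtain ⟨k, hk⟩ := h
        exact ⟨-k, by linear_combination -hk⟩)
  obtain ⟨k, hk⟩ := hd
  have key : (p : ℤ) ^ 2 = (x * a + 2 * y * b) ^ 2 + 2 * (p * k) ^ 2 := by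
    rw [← hk]
    calc (p : ℤ) ^ 2 = (x ^ 2 + 2 * y ^ 2) * (a ^ 2 + 2 * b ^ 2) := by rw [← h1, ← h2]; ring
      _ = _ := by ring
  have hk0 : k = 0 := by
    by_contra hk0
    have : 1 ≤ k ^ 2 := by have := sq_pos_of_ne_zero hk0 (R := ℤ); linarith
    nlinarith [sq_nonneg (x * a + 2 * y * b), pow_pos hpos 2]
  rw [hk0, mul_zero] at hk
  have : (p : ℤ) * (b ^ 2 - y ^ 2) = 0 := by
    linear_combination b ^ 2 * h1 - y ^ 2 * h2 + (x * b + y * a) * hk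
  rcases mul_eq_zero.mp this with h | h
  · exact absurd h hpos.ne'
  · linear_combination h2 - h1 + 2 * h

/-- Uniqueness of the representation of a prime by `X² + Y²`. -/
lemma sq_eq_of_prime_eq_sq_add_sq {p : ℕ} (hp : p.Prime) {x y a b : ℤ}
    (h1 : (p : ℤ) = x ^ 2 + y ^ 2) (h2 : (p : ℤ) = a ^ 2 + b ^ 2) :
    x ^ 2 = a ^ 2 ∨ x ^ 2 = b ^ 2 := by
  have hp' : Prime (p : ℤ) := Nat.prime_iff_prime_int.mp hp
  have hpos : (0 : ℤ) < p := by exact_mod_cast hp.pos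
  wlog hd : (p : ℤ) ∣ x * b - y * a generalizing b
  · have hm : (p : ℤ) ∣ (x * b - y * a) * (x * b + y * a) :=
      ⟨b ^ 2 - y ^ 2, by linear_combination (-b ^ 2) * h1 + y ^ 2 * h2⟩
    rcases hp'.dvd_or_dvd hm with h | h
    · exact absurd h hd
    · have := this (b := -b) (by rw [h2]; ring) (by
        obtain ⟨k, hk⟩ := h
        exact ⟨-k, by linear_combination -hk⟩)
      simpa using this
  obtain ⟨k, hk⟩ := hd
  have key : (p : ℤ) ^ 2 = (x * a + y * b) ^ 2 + (p * k) ^ 2 := by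
    rw [← hk]
    calc (p : ℤ) ^ 2 = (x ^ 2 + y ^ 2) * (a ^ 2 + b ^ 2) := by rw [← h1, ← h2]; ring
      _ = _ := by ring
  by_cases hk0 : k = 0
  · left
    rw [hk0, mul_zero] at hk
    have : (p : ℤ) * (b ^ 2 - y ^ 2) = 0 := by
      linear_combination b ^ 2 * h1 - y ^ 2 * h2 + (x * b + y * a) * hk
    rcases mul_eq_zero.mp this with h | h
    · exact absurd h hpos.ne'
    · linear_combination h2 - h1 + h
  · right
    have h1k : 1 ≤ k ^ 2 := by have := sq_pos_of_ne_zero hk0 (R := ℤ); linarith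
    have h0 : x * a + y * b = 0 := by
      have : (x * a + y * b) ^ 2 ≤ 0 := by nlinarith [pow_pos hpos 2]
      exact pow_eq_zero_iff two_ne_zero |>.mp (le_antisymm this (sq_nonneg _))
    have : (p : ℤ) * (x ^ 2 - b ^ 2) = 0 := by
      linear_combination x ^ 2 * h2 - b ^ 2 * h1 + (x * a - y * b) * h0
    rcases mul_eq_zero.mp this with h | h
    · exact absurd h hpos.ne'
    · linarith

open NumberTheorySymbols in
/-- For a prime `p = c⁴ + 16`, the element `c` is a square modulo `p` and `c² + 4` is not. -/
lemma jacobiSym_of_eq_pow_four_add {p c : ℕ} (hp : p.Prime) (h : p = c ^ 4 + 16) :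
    J(c | p) = 1 ∧ J((c ^ 2 + 4 : ℕ) | p) = -1 := by
  have hc : Odd c := by
    rcases Nat.even_or_odd c with ⟨d, rfl⟩ | hc
    · exfalso
      have h2 : 2 ∣ p := ⟨8 * d ^ 4 + 8, by rw [h]; ring⟩
      have := (Nat.prime_dvd_prime_iff_eq Nat.prime_two hp).mp h2
      omega
    · exact hc
  have hc8 : c ^ 2 % 8 = 1 := by
    obtain ⟨d, rfl⟩ := hc
    have : (2 * d + 1) ^ 2 = 4 * (d * (d + 1)) + 1 := by ring
    have h2 := (Nat.even_mul_succ_self d).two_dvd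
    omega
  have hp4 : p % 4 = 1 := by
    have : c ^ 4 = c ^ 2 * c ^ 2 := by ring
    have h3 : c ^ 2 * c ^ 2 % 8 = 1 := by rw [Nat.mul_mod, hc8]
    omega
  have hcop : ∀ n, (2 ^ n).Coprime c := fun n =>
    (Nat.coprime_two_left.mpr hc).pow_left n
  have hm8 : (c ^ 2 + 4) % 8 = 5 := by omega
  have hm : Odd (c ^ 2 + 4) := Nat.odd_iff.mpr (by omega)
  constructor
  · rw [jacobiSym.quadratic_reciprocity_one_mod_four' hc hp4,
      jacobiSym.mod_left' (a₂ := (4 : ℤ) ^ 2) (by rw [h]; push_cast; simp [pow_succ]),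
      jacobiSym.sq_one']
    have := hcop 2
    simpa [Int.gcd, Nat.Coprime] using this
  · rw [jacobiSym.quadratic_reciprocity_one_mod_four' hm hp4,
      jacobiSym.mod_left' (a₂ := -2 * (2 * c : ℤ) ^ 2) ?_, jacobiSym.mul_left,
      jacobiSym.at_neg_two hm, jacobiSym.sq_one', ZMod.χ₈'_nat_eq_if_mod_eight]
    · simp [hm8, show (c ^ 2 + 4) % 2 = 1 by omega]
    · have h1 : Nat.Coprime (2 * c) (c ^ 2 + 4) := by
        refine Nat.Coprime.mul_left (Nat.coprime_two_left.mpr hm) ?_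
        have : c.Coprime (4 + c * c) := by
          rw [Nat.coprime_add_mul_left_right]
          simpa using (hcop 2).symm
        rwa [show c ^ 2 + 4 = 4 + c * c by ring]
      rw [show (2 * c : ℤ) = ((2 * c : ℕ) : ℤ) by push_cast; ring, Int.gcd_natCast_natCast]
      exact h1
    · refine Int.modEq_iff_dvd.mpr ⟨-(c ^ 2 + 4), ?_⟩
      rw [h]
      push_cast
      ring

end Arithmetic

section OcticCharacter

open Complex

/-- The primitive eighth root of unity `(1 + i) / √2`. -/
def zetaEight : ℂ := (1 + I) * (√2 : ℝ) / 2

lemma ofReal_sqrt_two_sq : ((√2 : ℝ) : ℂ) ^ 2 = 2 := by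
  rw [← ofReal_pow, Real.sq_sqrt (by norm_num)]
  norm_num

lemma zetaEight_sq : zetaEight ^ 2 = I := by
  have h := ofReal_sqrt_two_sq
  rw [zetaEight]
  linear_combination (1 + I) ^ 2 / 4 * h + 1 / 2 * I_sq

lemma zetaEight_pow_four : zetaEight ^ 4 = -1 := by
  rw [show zetaEight ^ 4 = (zetaEight ^ 2) ^ 2 by ring, zetaEight_sq, I_sq]

lemma zetaEight_pow_eight : zetaEight ^ 8 = 1 := by
  rw [show zetaEight ^ 8 = (zetaEight ^ 4) ^ 2 by ring, zetaEight_pow_four]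
  norm_num

lemma zetaEight_sub : zetaEight - zetaEight * I = (√2 : ℝ) := by
  rw [zetaEight]
  linear_combination (-((√2 : ℝ) : ℂ) / 2) * I_sq

lemma zetaEight_add : zetaEight + zetaEight * I = I * (√2 : ℝ) := by
  rw [zetaEight]
  linear_combination (((√2 : ℝ) : ℂ) / 2) * I_sq

lemma isPrimitiveRoot_zetaEight : IsPrimitiveRoot zetaEight 8 := by
  have : orderOf zetaEight = 2 ^ (2 + 1) := by
    refine orderOf_eq_prime_pow ?_ ?_
    · norm_num [zetaEight_pow_four]
    · exact zetaEight_pow_eight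
  rw [IsPrimitiveRoot.iff_orderOf, this]
  norm_num

/-- Integer coordinates of the odd powers of an eighth root of unity (or zero). -/
lemma exists_coords_odd {z : ℂ} (hz : z = 0 ∨ ∃ k < 8, z = zetaEight ^ k) :
    ∃ a₀ a₁ a₂ a₃ : ℤ, z = a₀ + a₁ * zetaEight + a₂ * I + a₃ * (zetaEight * I) ∧
      z ^ 3 = a₀ + a₃ * zetaEight - a₂ * I + a₁ * (zetaEight * I) ∧
      z ^ 5 = a₀ - a₁ * zetaEight + a₂ * I - a₃ * (zetaEight * I) ∧
      z ^ 7 = a₀ - a₃ * zetaEight - a₂ * I - a₁ * (zetaEight * I) ∧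
      (z = 1 → a₀ = 1 ∧ a₁ = 0 ∧ a₂ = 0 ∧ a₃ = 0) ∧
      (z = 0 → a₀ + a₁ + a₂ + a₃ = 0) ∧ (z ≠ 0 → (a₀ + a₁ + a₂ + a₃) % 2 = 1) := by
  have h2 := zetaEight_sq
  have h4 := zetaEight_pow_four
  have h8 := zetaEight_pow_eight
  have h0 : zetaEight ≠ 0 := isPrimitiveRoot_zetaEight.ne_zero (by norm_num)
  have hI : I = zetaEight ^ 2 := h2.symm
  rcases hz with rfl | ⟨k, hk, rfl⟩
  · exact ⟨0, 0, 0, 0, by simp⟩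
  have hne : k ≠ 0 → zetaEight ^ k ≠ 1 :=
    fun hk0 => isPrimitiveRoot_zetaEight.pow_ne_one_of_pos_of_lt hk0 hk
  have hz0 : zetaEight ^ k ≠ 0 := pow_ne_zero _ h0
  rw [hI]
  generalize zetaEight = w at *
  suffices h : ∃ a₀ a₁ a₂ a₃ : ℤ, w ^ k = a₀ + a₁ * w + a₂ * w ^ 2 + a₃ * (w * w ^ 2) ∧
      (w ^ k) ^ 3 = a₀ + a₃ * w - a₂ * w ^ 2 + a₁ * (w * w ^ 2) ∧
      (w ^ k) ^ 5 = a₀ - a₁ * w + a₂ * w ^ 2 - a₃ * (w * w ^ 2) ∧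
      (w ^ k) ^ 7 = a₀ - a₃ * w - a₂ * w ^ 2 - a₁ * (w * w ^ 2) ∧
      (k = 0 → a₀ = 1 ∧ a₁ = 0 ∧ a₂ = 0 ∧ a₃ = 0) ∧ (a₀ + a₁ + a₂ + a₃) % 2 = 1 by
    obtain ⟨a₀, a₁, a₂, a₃, e1, e2, e3, e4, e5, e6⟩ := h
    exact ⟨a₀, a₁, a₂, a₃, e1, e2, e3, e4,
      fun h => e5 (by_contra fun hk0 => hne hk0 h), fun h => absurd h hz0, fun _ => e6⟩
  have red : ∀ m, w ^ m = w ^ (m % 8) := fun m => by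
    conv_lhs => rw [← Nat.div_add_mod m 8, pow_add, pow_mul, h8, one_pow, one_mul]
  have r4 : w ^ 4 = -1 := h4
  have r5 : w ^ 5 = -w := by linear_combination w * h4
  have r6 : w ^ 6 = -w ^ 2 := by linear_combination w ^ 2 * h4
  have r7 : w ^ 7 = -w ^ 3 := by linear_combination w ^ 3 * h4
  interval_cases k
  · refine ⟨1, 0, 0, 0, ?_, ?_, ?_, ?_, ?_, ?_⟩ <;> norm_num
  · refine ⟨0, 1, 0, 0, ?_, ?_, ?_, ?_, ?_, ?_⟩ <;> norm_num <;> (try simp only [r5, r7]) <;> ring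
  · refine ⟨0, 0, 1, 0, ?_, ?_, ?_, ?_, ?_, ?_⟩ <;> norm_num [← pow_mul] <;>
      simp only [r6, red 10, red 14]
  · refine ⟨0, 0, 0, 1, ?_, ?_, ?_, ?_, ?_, ?_⟩ <;> norm_num [← pow_mul] <;>
      (try simp only [red 9, red 15, red 21, r5, r7]) <;> ring
  · refine ⟨-1, 0, 0, 0, ?_, ?_, ?_, ?_, ?_, ?_⟩ <;> norm_num [← pow_mul] <;>
      simp only [red 12, red 20, red 28, r4]
  · refine ⟨0, -1, 0, 0, ?_, ?_, ?_, ?_, ?_, ?_⟩ <;> norm_num [← pow_mul] <;>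
      simp only [red 15, red 25, red 35, r5, r7] <;> ring
  · refine ⟨0, 0, -1, 0, ?_, ?_, ?_, ?_, ?_, ?_⟩ <;> norm_num [← pow_mul] <;>
      simp only [red 18, red 30, red 42, r6]
  · refine ⟨0, 0, 0, -1, ?_, ?_, ?_, ?_, ?_, ?_⟩ <;> norm_num [← pow_mul] <;>
      simp only [red 21, red 35, red 49, r5, r7] <;> ring

/-- Integer coordinates of the squares of an eighth root of unity (or zero). -/
lemma exists_coords_even {z : ℂ} (hz : z = 0 ∨ ∃ k < 8, z = zetaEight ^ k) :
    ∃ a₀ a₁ : ℤ, z ^ 2 = a₀ + a₁ * I ∧ z ^ 6 = a₀ - a₁ * I ∧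
      (z = 1 → a₀ = 1 ∧ a₁ = 0) ∧ (z = 0 → a₀ + a₁ = 0) ∧ (z ≠ 0 → (a₀ + a₁) % 2 = 1) := by
  have h0 : zetaEight ≠ 0 := isPrimitiveRoot_zetaEight.ne_zero (by norm_num)
  rcases hz with rfl | ⟨k, hk, rfl⟩
  · exact ⟨0, 0, by simp⟩
  have hne : k ≠ 0 → zetaEight ^ k ≠ 1 :=
    fun hk0 => isPrimitiveRoot_zetaEight.pow_ne_one_of_pos_of_lt hk0 hk
  have hz0 : zetaEight ^ k ≠ 0 := pow_ne_zero _ h0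
  have e2 : (zetaEight ^ k) ^ 2 = I ^ k := by rw [← zetaEight_sq]; ring
  have e6 : (zetaEight ^ k) ^ 6 = (I ^ k) ^ 3 := by rw [← zetaEight_sq]; ring
  rw [e2, e6]
  suffices h : ∃ a₀ a₁ : ℤ, I ^ k = a₀ + a₁ * I ∧ (I ^ k) ^ 3 = a₀ - a₁ * I ∧
      (k = 0 → a₀ = 1 ∧ a₁ = 0) ∧ (a₀ + a₁) % 2 = 1 by
    obtain ⟨a₀, a₁, e1, e2, e5, e6⟩ := h
    exact ⟨a₀, a₁, e1, e2,
      fun h => e5 (by_contra fun hk0 => hne hk0 h), fun h => absurd h hz0, fun _ => e6⟩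
  have r2 := I_sq
  have r3 : I ^ 3 = -I := by linear_combination I * I_sq
  have r4 : I ^ 4 = 1 := I_pow_four
  have red : ∀ n r, I ^ (4 * n + r) = I ^ r := fun n r => by rw [pow_add, pow_mul, r4]; simp
  interval_cases k
  · refine ⟨1, 0, ?_, ?_, ?_, ?_⟩ <;> norm_num
  · refine ⟨0, 1, ?_, ?_, ?_, ?_⟩ <;> norm_num
  · refine ⟨-1, 0, ?_, ?_, ?_, ?_⟩ <;> norm_num
  · refine ⟨0, -1, ?_, ?_, ?_, ?_⟩ <;> norm_num [← pow_mul]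
    simp [pow_succ]
  · refine ⟨1, 0, ?_, ?_, ?_, ?_⟩ <;> norm_num
  · refine ⟨0, 1, ?_, ?_, ?_, ?_⟩ <;> norm_num [← pow_mul]
    · simp
    · rw [red 3 3, r3]
  · refine ⟨-1, 0, ?_, ?_, ?_, ?_⟩ <;> norm_num [← pow_mul]
    · rw [red 1 2, r2]
    · rw [red 4 2, r2]
  · refine ⟨0, -1, ?_, ?_, ?_, ?_⟩ <;> norm_num [← pow_mul]
    · rw [red 1 3, r3]
    · simp

end OcticCharacter

section OcticCharacterModPrime

open Complex

variable {p : ℕ} [Fact p.Prime] {γ : ZMod p}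

lemma ne_zero_of_orderOf_eq (hγ : orderOf γ = p - 1) : γ ≠ 0 := by
  rintro rfl
  have h2 := (Fact.out : p.Prime).two_le
  have h := pow_orderOf_eq_one (0 : ZMod p)
  rw [hγ, zero_pow (by omega)] at h
  exact zero_ne_one h

lemma mem_zpowers_of_orderOf_eq (hγ : orderOf γ = p - 1) (g : (ZMod p)ˣ) :
    g ∈ Subgroup.zpowers (Units.mk0 γ (ne_zero_of_orderOf_eq hγ)) := by
  have h : Subgroup.zpowers (Units.mk0 γ (ne_zero_of_orderOf_eq hγ)) = ⊤ := by
    apply Subgroup.eq_top_of_card_eq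
    rw [Nat.card_zpowers, ← orderOf_units, Units.val_mk0, hγ, Nat.card_eq_fintype_card,
      ZMod.card_units]
  rw [h]
  trivial

lemma exists_eq_pow_of_ne_zero (hγ : orderOf γ = p - 1) {t : ZMod p} (ht : t ≠ 0) :
    ∃ n < p - 1, t = γ ^ n := by
  have h := mem_zpowers_of_orderOf_eq hγ (Units.mk0 t ht)
  rw [← mem_powers_iff_mem_zpowers] at h
  obtain ⟨n, hn⟩ := h
  refine ⟨n % (p - 1), Nat.mod_lt _ ?_, ?_⟩
  · have := (Fact.out : p.Prime).two_le
    omega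
  · have := congrArg Units.val hn
    simp only [Units.val_pow_eq_pow_val, Units.val_mk0] at this
    rw [← this, ← hγ, pow_mod_orderOf]

/-- There is an octic character modulo `p` with a prescribed value at a primitive root. -/
lemma exists_mulChar_apply_eq_zetaEight (hp : p % 16 = 1) (hγ : orderOf γ = p - 1) :
    ∃ χ : MulChar (ZMod p) ℂ, χ γ = zetaEight := by
  have h0 : zetaEight ≠ 0 := isPrimitiveRoot_zetaEight.ne_zero (by norm_num)
  have hmem : Units.mk0 zetaEight h0 ∈ rootsOfUnity (Fintype.card (ZMod p)ˣ) ℂ := by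
    rw [_root_.mem_rootsOfUnity, ZMod.card_units, Units.ext_iff]
    obtain ⟨k, hk⟩ : 8 ∣ p - 1 := by omega
    simp [hk, pow_mul, zetaEight_pow_eight]
  refine ⟨MulChar.ofRootOfUnity hmem (mem_zpowers_of_orderOf_eq hγ), ?_⟩
  exact MulChar.ofRootOfUnity_spec hmem (mem_zpowers_of_orderOf_eq hγ)

lemma zetaEight_pow_mod (n : ℕ) : zetaEight ^ n = zetaEight ^ (n % 8) := by
  conv_lhs => rw [← Nat.div_add_mod n 8, pow_add, pow_mul, zetaEight_pow_eight, one_pow, one_mul]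

variable {χ : MulChar (ZMod p) ℂ}

lemma octic_apply (hγ : orderOf γ = p - 1) (hχ : χ γ = zetaEight) (t : ZMod p) :
    χ t = 0 ∨ ∃ k < 8, χ t = zetaEight ^ k := by
  by_cases ht : t = 0
  · left
    rw [ht, MulChar.map_zero]
  · right
    obtain ⟨n, -, rfl⟩ := exists_eq_pow_of_ne_zero hγ ht
    exact ⟨n % 8, Nat.mod_lt _ (by norm_num), by rw [map_pow, hχ, zetaEight_pow_mod]⟩

lemma octic_apply_ne_zero {t : ZMod p} (ht : t ≠ 0) : χ t ≠ 0 :=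
  (ht.isUnit.map χ).ne_zero

lemma octic_pow_eight (hγ : orderOf γ = p - 1) (hχ : χ γ = zetaEight) : χ ^ 8 = 1 := by
  ext t
  rw [MulChar.pow_apply_coe, MulChar.one_apply_coe]
  obtain ⟨n, -, hn⟩ := exists_eq_pow_of_ne_zero hγ t.ne_zero
  rw [hn, map_pow, hχ, ← pow_mul, mul_comm, pow_mul, zetaEight_pow_eight, one_pow]

lemma octic_pow_ne_one (hγ : orderOf γ = p - 1) (hχ : χ γ = zetaEight) {j : ℕ} (hj : ¬ 8 ∣ j) :
    χ ^ j ≠ 1 := by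
  intro h
  have h1 := congrArg (fun ψ : MulChar (ZMod p) ℂ => ψ γ) h
  rw [MulChar.pow_apply' _ (by rintro rfl; simp at hj), hχ,
    MulChar.one_apply (ne_zero_of_orderOf_eq hγ).isUnit] at h1
  exact hj (isPrimitiveRoot_zetaEight.dvd_of_pow_eq_one _ h1)

lemma octic_apply_neg_one (hp : p % 16 = 1) (hγ : orderOf γ = p - 1) (hχ : χ γ = zetaEight) :
    χ (-1) = 1 := by
  have hp2 := (Fact.out : p.Prime).two_le
  have hsq : γ ^ ((p - 1) / 2) * γ ^ ((p - 1) / 2) = 1 := by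
    rw [← pow_add, ← hγ, show orderOf γ / 2 + orderOf γ / 2 = orderOf γ by omega,
      pow_orderOf_eq_one]
  have hne : γ ^ ((p - 1) / 2) ≠ 1 := by
    intro h
    have := orderOf_dvd_of_pow_eq_one h
    rw [hγ] at this
    have := Nat.le_of_dvd (by omega) this
    omega
  have h : γ ^ ((p - 1) / 2) = -1 := (mul_self_eq_one_iff.mp hsq).resolve_left hne
  obtain ⟨k, hk⟩ : 8 ∣ (p - 1) / 2 := by omega
  rw [← h, map_pow, hχ, hk, pow_mul, zetaEight_pow_eight, one_pow]

lemma octic_pow_four (hp : p % 16 = 1) (hγ : orderOf γ = p - 1) (hχ : χ γ = zetaEight)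
    (t : ZMod p) : (χ ^ 4) t = (quadraticChar (ZMod p) t : ℂ) := by
  have hp2 := (Fact.out : p.Prime).two_le
  have hγ0 := ne_zero_of_orderOf_eq hγ
  have hq : quadraticChar (ZMod p) γ = -1 := by
    rcases quadraticChar_dichotomy hγ0 with h | h
    · exfalso
      obtain ⟨s, hs⟩ := (quadraticChar_one_iff_isSquare hγ0).mp h
      have hs0 : s ≠ 0 := by
        rintro rfl
        simp [hs] at hγ0
      have h1 : γ ^ ((p - 1) / 2) = 1 := by
        rw [hs, ← sq, ← pow_mul, show 2 * ((p - 1) / 2) = p - 1 by omega]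
        exact ZMod.pow_card_sub_one_eq_one hs0
      have := orderOf_dvd_of_pow_eq_one h1
      rw [hγ] at this
      have := Nat.le_of_dvd (by omega) this
      omega
    · exact h
  by_cases ht : t = 0
  · simp [ht, MulChar.map_zero]
  · obtain ⟨n, -, rfl⟩ := exists_eq_pow_of_ne_zero hγ ht
    rw [MulChar.pow_apply' _ (by norm_num), map_pow, map_pow, hχ, hq, ← pow_mul, mul_comm, pow_mul,
      zetaEight_pow_four]
    push_cast
    rfl

lemma ringChar_ne_two (hp : p % 16 = 1) : ringChar (ZMod p) ≠ 2 := by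
  rw [ZMod.ringChar_zmod_n]
  omega

section Sums

variable {F : Type*} [Field F] [Fintype F] [DecidableEq F]

lemma two_mul_dvd_sum_comp_sq (hF : ringChar F ≠ 2) {G : F → ℤ} {m : ℤ} (h0 : G 0 = 0)
    (hG : ∀ t, m ∣ G t) : 2 * m ∣ ∑ s : F, G (s ^ 2) := by
  rw [sum_comp_sq hF]
  refine Finset.dvd_sum fun t _ => ?_
  by_cases ht : t = 0
  · simp [ht, h0]
  · refine mul_dvd_mul ?_ (hG t)
    rcases quadraticChar_dichotomy ht with h | h <;> simp [h]

end Sums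

/-- A sum `∑ g(1 - s²)` modulo four, for `g` odd away from zero. -/
lemma sum_one_sub_sq_emod_four (hp : p % 16 = 1) {g : ZMod p → ℤ} (h1 : g 1 = 1) (h0 : g 0 = 0)
    (hg : ∀ t, t ≠ 0 → g t % 2 = 1) : (∑ s : ZMod p, g (1 - s ^ 2)) % 4 = 3 := by
  have hp2 := (Fact.out : p.Prime).two_le
  have key := two_mul_dvd_sum_comp_sq (ringChar_ne_two hp) (m := 2)
    (G := fun t : ZMod p => g (1 - t) - 1 + if t = 1 then 1 else 0) (by simp [h1]) (by
      intro t
      by_cases ht : t = 1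
      · simp [ht, h0]
      · have := hg (1 - t) (sub_ne_zero.mpr (Ne.symm ht))
        simp only [ht, if_false]
        omega)
  have hcard : ∑ s : ZMod p, (if s ^ 2 = 1 then (1 : ℤ) else 0) = 2 := by
    rw [sum_comp_sq (ringChar_ne_two hp) (fun t : ZMod p => if t = 1 then (1 : ℤ) else 0)]
    simp
  simp only [Finset.sum_add_distrib, Finset.sum_sub_distrib, hcard] at key
  simp only [Finset.sum_const, Finset.card_univ, ZMod.card, nsmul_eq_mul,
    mul_one] at key
  omega

lemma octic_jacobiSum_reflect (hp : p % 16 = 1) (hγ : orderOf γ = p - 1) (hχ : χ γ = zetaEight)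
    {i j k : ℕ} (hi : i ≠ 0) (h : 8 ∣ i + j + k) :
    jacobiSum (χ ^ i) (χ ^ j) = jacobiSum (χ ^ i) (χ ^ k) := by
  rw [jacobiSum_eq_apply_neg_one_mul, MulChar.pow_apply' _ hi, octic_apply_neg_one hp hγ hχ,
    one_pow, one_mul]
  congr 1
  rw [inv_eq_iff_mul_eq_one, ← pow_add, ← pow_add]
  obtain ⟨m, hm⟩ := h
  rw [hm, pow_mul, octic_pow_eight hγ hχ, one_pow]

lemma octic_jacobiSum_four (hp : p % 16 = 1) (hγ : orderOf γ = p - 1) (hχ : χ γ = zetaEight)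
    {j : ℕ} (hj : ¬ 8 ∣ j) :
    jacobiSum (χ ^ j) (χ ^ 4) = ∑ s : ZMod p, χ (1 - s ^ 2) ^ j := by
  rw [jacobiSum_quadratic (ringChar_ne_two hp) _ _ (octic_pow_ne_one hγ hχ hj)
    (octic_pow_four hp hγ hχ)]
  refine Finset.sum_congr rfl fun s _ => ?_
  rw [MulChar.pow_apply' _ (by rintro rfl; simp at hj)]

lemma octic_jacobiSum_four_odd (hp : p % 16 = 1) (hγ : orderOf γ = p - 1)
    (hχ : χ γ = zetaEight) :
    ∃ n₀ n₁ : ℤ, n₀ % 4 = 3 ∧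
      jacobiSum (χ ^ 1) (χ ^ 4) = n₀ + n₁ * (I * (√2 : ℝ)) ∧
      jacobiSum (χ ^ 3) (χ ^ 4) = n₀ + n₁ * (I * (√2 : ℝ)) ∧
      jacobiSum (χ ^ 5) (χ ^ 4) = n₀ - n₁ * (I * (√2 : ℝ)) ∧
      jacobiSum (χ ^ 7) (χ ^ 4) = n₀ - n₁ * (I * (√2 : ℝ)) := by
  choose a₀ a₁ a₂ a₃ e1 e3 e5 e7 hone hzero hodd using
    fun t : ZMod p => exists_coords_odd (octic_apply hγ hχ t)
  set n₀ := ∑ s : ZMod p, a₀ (1 - s ^ 2) with hn₀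
  set n₁ := ∑ s : ZMod p, a₁ (1 - s ^ 2) with hn₁
  set n₂ := ∑ s : ZMod p, a₂ (1 - s ^ 2) with hn₂
  set n₃ := ∑ s : ZMod p, a₃ (1 - s ^ 2) with hn₃
  have k1 : jacobiSum (χ ^ 1) (χ ^ 4) =
      n₀ + n₁ * zetaEight + n₂ * I + n₃ * (zetaEight * I) := by
    rw [octic_jacobiSum_four hp hγ hχ (by norm_num)]
    simp only [pow_one, e1, Finset.sum_add_distrib, ← Finset.sum_mul, hn₀, hn₁, hn₂, hn₃,
      Int.cast_sum]
  have k3 : jacobiSum (χ ^ 3) (χ ^ 4) =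
      n₀ + n₃ * zetaEight - n₂ * I + n₁ * (zetaEight * I) := by
    rw [octic_jacobiSum_four hp hγ hχ (by norm_num)]
    simp only [e3, Finset.sum_add_distrib, Finset.sum_sub_distrib, ← Finset.sum_mul, hn₀, hn₁,
      hn₂, hn₃, Int.cast_sum]
  have k5 : jacobiSum (χ ^ 5) (χ ^ 4) =
      n₀ - n₁ * zetaEight + n₂ * I - n₃ * (zetaEight * I) := by
    rw [octic_jacobiSum_four hp hγ hχ (by norm_num)]
    simp only [e5, Finset.sum_add_distrib, Finset.sum_sub_distrib, ← Finset.sum_mul, hn₀, hn₁,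
      hn₂, hn₃, Int.cast_sum]
  have k7 : jacobiSum (χ ^ 7) (χ ^ 4) =
      n₀ - n₃ * zetaEight - n₂ * I - n₁ * (zetaEight * I) := by
    rw [octic_jacobiSum_four hp hγ hχ (by norm_num)]
    simp only [e7, Finset.sum_sub_distrib, ← Finset.sum_mul, hn₀, hn₁,
      hn₂, hn₃, Int.cast_sum]
  have h13 : jacobiSum (χ ^ 1) (χ ^ 4) = jacobiSum (χ ^ 3) (χ ^ 4) := by
    rw [octic_jacobiSum_reflect hp hγ hχ (k := 3) (by norm_num) (by norm_num), jacobiSum_comm,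
      octic_jacobiSum_reflect hp hγ hχ (k := 4) (by norm_num) (by norm_num)]
  have hlin : ((n₁ : ℂ) - n₃) * (√2 : ℝ) + 2 * n₂ * I = 0 := by
    rw [k1, k3] at h13
    rw [← zetaEight_sub]
    linear_combination h13
  have hre := congrArg Complex.re hlin
  have him := congrArg Complex.im hlin
  simp at hre him
  have h31 : n₃ = n₁ := by
    have : (n₁ : ℝ) - n₃ = 0 := hre
    exact_mod_cast (sub_eq_zero.mp this).symm
  have hodd' := sum_one_sub_sq_emod_four hp (g := fun t => a₀ t + a₁ t + a₂ t + a₃ t)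
    (by obtain ⟨h, h', h'', h'''⟩ := hone 1 (map_one χ); simp [h, h', h'', h'''])
    (hzero 0 (MulChar.map_zero χ)) (fun t ht => hodd t (octic_apply_ne_zero ht))
  simp only [Finset.sum_add_distrib, ← hn₀, ← hn₁, ← hn₂, ← hn₃] at hodd'
  have heven : 2 ∣ n₁ := by
    have := two_mul_dvd_sum_comp_sq (ringChar_ne_two hp) (m := 1)
      (G := fun t : ZMod p => a₁ (1 - t)) (by simp [(hone 1 (map_one χ)).2.1])
      (fun t => one_dvd _)
    simpa using this
  rw [h31] at k1 k3 k5 k7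
  rw [him] at k1 k3 k5 k7
  push_cast at k1 k3 k5 k7
  refine ⟨n₀, n₁, by omega, ?_, ?_, ?_, ?_⟩ <;> rw [← zetaEight_add]
  · rw [k1]; ring
  · rw [k3]; ring
  · rw [k5]; ring
  · rw [k7]; ring

lemma octic_jacobiSum_four_even (hp : p % 16 = 1) (hγ : orderOf γ = p - 1)
    (hχ : χ γ = zetaEight) :
    ∃ m₀ m₁ : ℤ, (m₀ + m₁) % 4 = 3 ∧ m₁ % 2 = 0 ∧
      jacobiSum (χ ^ 2) (χ ^ 4) = m₀ + m₁ * I ∧ jacobiSum (χ ^ 6) (χ ^ 4) = m₀ - m₁ * I := by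
  choose a₀ a₁ e2 e6 hone hzero hodd using
    fun t : ZMod p => exists_coords_even (octic_apply hγ hχ t)
  refine ⟨∑ s : ZMod p, a₀ (1 - s ^ 2), ∑ s : ZMod p, a₁ (1 - s ^ 2), ?_, ?_, ?_, ?_⟩
  · rw [← Finset.sum_add_distrib]
    refine sum_one_sub_sq_emod_four hp (g := fun t => a₀ t + a₁ t) ?_
      (hzero 0 (MulChar.map_zero χ)) (fun t ht => hodd t (octic_apply_ne_zero ht))
    obtain ⟨h, h'⟩ := hone 1 (map_one χ)
    simp [h, h']
  · have := two_mul_dvd_sum_comp_sq (ringChar_ne_two hp) (m := 1)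
      (G := fun t : ZMod p => a₁ (1 - t)) (by simp [(hone 1 (map_one χ)).2])
      (fun t => one_dvd _)
    rw [mul_one] at this
    exact Int.emod_eq_zero_of_dvd this
  · rw [octic_jacobiSum_four hp hγ hχ (by norm_num)]
    simp only [e2, Finset.sum_add_distrib, ← Finset.sum_mul, Int.cast_sum]
  · rw [octic_jacobiSum_four hp hγ hχ (by norm_num)]
    simp only [e6, Finset.sum_sub_distrib, ← Finset.sum_mul, Int.cast_sum]

lemma octic_jacobiSum_mul (hγ : orderOf γ = p - 1) (hχ : χ γ = zetaEight) {i j k l : ℕ}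
    (hi : ¬ 8 ∣ i) (hj : ¬ 8 ∣ j) (hij : ¬ 8 ∣ i + j) (hk : 8 ∣ i + k) (hl : 8 ∣ j + l) :
    jacobiSum (χ ^ i) (χ ^ j) * jacobiSum (χ ^ k) (χ ^ l) = p := by
  have hinv : ∀ {a b : ℕ}, 8 ∣ a + b → χ ^ b = (χ ^ a)⁻¹ := by
    rintro a b ⟨m, hm⟩
    rw [eq_inv_iff_mul_eq_one, ← pow_add, add_comm, hm, pow_mul, octic_pow_eight hγ hχ, one_pow]
  rw [hinv hk, hinv hl, jacobiSum_mul_jacobiSum_inv _ (octic_pow_ne_one hγ hχ hi)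
    (octic_pow_ne_one hγ hχ hj) (by rw [← pow_add]; exact octic_pow_ne_one hγ hχ hij), ZMod.card]
  rw [ZMod.ringChar_zmod_n, ringChar.eq_zero]
  exact (Fact.out : p.Prime).ne_zero.symm

lemma octic_jacobiSum_self (hp : p % 16 = 1) (hγ : orderOf γ = p - 1) (hχ : χ γ = zetaEight)
    (h4 : χ 4 = -1) {j : ℕ} (hj : ¬ 8 ∣ j) :
    jacobiSum (χ ^ j) (χ ^ j) = (-1) ^ j * jacobiSum (χ ^ j) (χ ^ 4) := by
  rw [← jacobiSum_self (ringChar_ne_two hp) _ _ (octic_pow_ne_one hγ hχ hj)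
    (octic_pow_four hp hγ hχ), MulChar.pow_apply' _ (by rintro rfl; simp at hj), h4, ← mul_assoc,
    ← mul_pow]
  norm_num

lemma octic_jacobiSum_inv (hp : p % 16 = 1) (hγ : orderOf γ = p - 1) (hχ : χ γ = zetaEight)
    {i j : ℕ} (hi : ¬ 8 ∣ i) (hij : 8 ∣ i + j) : jacobiSum (χ ^ i) (χ ^ j) = -1 := by
  have hinv : χ ^ j = (χ ^ i)⁻¹ := by
    obtain ⟨m, hm⟩ := hij
    rw [eq_inv_iff_mul_eq_one, ← pow_add, add_comm, hm, pow_mul, octic_pow_eight hγ hχ, one_pow]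
  rw [hinv, jacobiSum_nontrivial_inv (octic_pow_ne_one hγ hχ hi),
    MulChar.pow_apply' _ (by rintro rfl; simp at hi), octic_apply_neg_one hp hγ hχ, one_pow]

lemma octic_jacobiSum_mul_jacobiSum (hγ : orderOf γ = p - 1) (hχ : χ γ = zetaEight)
    {i j k : ℕ} (hij : ¬ 8 ∣ i + j) (hjk : ¬ 8 ∣ j + k) (hijk : ¬ 8 ∣ i + j + k) :
    jacobiSum (χ ^ i) (χ ^ j) * jacobiSum (χ ^ (i + j)) (χ ^ k) =
      jacobiSum (χ ^ j) (χ ^ k) * jacobiSum (χ ^ i) (χ ^ (j + k)) := by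
  have h {n : ℕ} (hn : ¬ 8 ∣ n) : χ ^ n ≠ 1 := octic_pow_ne_one hγ hχ hn
  have hF : (Fintype.card (ZMod p) : ℂ) ≠ 0 := by
    rw [ZMod.card]
    exact_mod_cast (Fact.out : p.Prime).ne_zero
  have := jacobiSum_mul_jacobiSum hF (χ ^ i) (χ ^ j) (χ ^ k)
    (by rw [← pow_add]; exact h hij) (by rw [← pow_add]; exact h hjk)
    (by rw [← pow_add, ← pow_add]; exact h hijk)
  rwa [← pow_add, ← pow_add] at this

/-- For `p = c⁴ + 16`, the number `2` is a quadratic but not a quartic residue. -/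
lemma octic_apply_four (hp : p % 16 = 1) (hγ : orderOf γ = p - 1) (hχ : χ γ = zetaEight) {c : ℕ}
    (h : p = c ^ 4 + 16) : χ 4 = -1 := by
  have hpp := (Fact.out : p.Prime)
  obtain ⟨h1, h2⟩ := jacobiSym_of_eq_pow_four_add hpp h
  have hJ : ∀ m : ℕ, χ (m : ZMod p) ^ 4 = (jacobiSym m p : ℂ) := by
    intro m
    rw [← MulChar.pow_apply' _ (by norm_num), octic_pow_four hp hγ hχ, ← jacobiSym.legendreSym.to_jacobiSym,
      legendreSym]
    simp
  have hz := hJ (c ^ 2 + 4)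
  have hw := hJ c
  rw [h2] at hz
  rw [h1] at hw
  have hp0 : (c : ZMod p) ^ 4 + 16 = 0 := by
    have : ((c ^ 4 + 16 : ℕ) : ZMod p) = 0 := (ZMod.natCast_eq_zero_iff _ p).mpr (h ▸ dvd_rfl)
    exact_mod_cast this
  have hsq : ((c ^ 2 + 4 : ℕ) : ZMod p) ^ 2 = 2 ^ 3 * (c : ZMod p) ^ 2 := by
    push_cast
    linear_combination hp0
  have hmul := congrArg χ hsq
  rw [map_mul, map_pow, map_pow, map_pow] at hmul
  have h20 : (2 : ZMod p) ≠ 0 := Ring.two_ne_zero (ringChar_ne_two hp)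
  have h28 : χ 2 ^ 8 = 1 := by
    rw [← MulChar.pow_apply' _ (by norm_num), octic_pow_eight hγ hχ,
      MulChar.one_apply h20.isUnit]
  have h26 : χ 2 ^ 6 = -1 := by
    have : χ 2 ^ 6 * χ (c : ZMod p) ^ 4 = -1 := by
      calc χ 2 ^ 6 * χ (c : ZMod p) ^ 4 = (χ 2 ^ 3 * χ (c : ZMod p) ^ 2) ^ 2 := by ring
        _ = χ ((c ^ 2 + 4 : ℕ) : ZMod p) ^ 4 := by rw [← hmul]; ring
        _ = -1 := by rw [hz]; norm_num
    rw [hw] at this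
    simpa using this
  rw [show (4 : ZMod p) = 2 ^ 2 by norm_num, map_pow]
  linear_combination χ 2 ^ 2 * h26 - h28

/-- The Jacobi sums of the powers of an octic character when `p = x² + 16 = (x - 4)² + 2b²`. -/
lemma octic_jacobiSum_table (hp : p % 16 = 1) (hγ : orderOf γ = p - 1) (hχ : χ γ = zetaEight)
    {x b : ℤ} (hx : (p : ℤ) = x ^ 2 + 16) (hab : (p : ℤ) = (x - 4) ^ 2 + 2 * b ^ 2)
    (hx4 : x % 4 = 1) :
    ∃ m n : ℤ, (m = 4 ∨ m = -4) ∧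
      (jacobiSum (χ ^ 2) (χ ^ 2) = -x + m * I ∧ jacobiSum (χ ^ 6) (χ ^ 6) = -x - m * I ∧
        jacobiSum (χ ^ 1) (χ ^ 5) = x - m * I ∧ jacobiSum (χ ^ 3) (χ ^ 7) = x + m * I) ∧
      (jacobiSum (χ ^ 1) (χ ^ 3) = 4 - x + n * (I * (√2 : ℝ)) ∧
        jacobiSum (χ ^ 5) (χ ^ 7) = 4 - x - n * (I * (√2 : ℝ)) ∧
        jacobiSum (χ ^ 1) (χ ^ 1) = x - 4 - n * (I * (√2 : ℝ)) ∧
        jacobiSum (χ ^ 3) (χ ^ 3) = x - 4 - n * (I * (√2 : ℝ)) ∧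
        jacobiSum (χ ^ 5) (χ ^ 5) = x - 4 + n * (I * (√2 : ℝ)) ∧
        jacobiSum (χ ^ 7) (χ ^ 7) = x - 4 + n * (I * (√2 : ℝ))) := by
  have hpp := (Fact.out : p.Prime)
  have hp0 : (p : ℂ) ≠ 0 := by exact_mod_cast hpp.ne_zero
  have hs := ofReal_sqrt_two_sq
  obtain ⟨c, hc⟩ : ∃ c : ℕ, p = c ^ 4 + 16 := by
    have h4 : b ^ 2 = 4 * x := by linarith
    obtain ⟨d, rfl⟩ : Even b := by
      have : Even (b ^ 2) := ⟨2 * x, by rw [h4]; ring⟩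
      exact (Int.even_pow.mp this).1
    refine ⟨d.natAbs, ?_⟩
    have hd : x = d ^ 2 := by linarith
    zify
    rw [hx, hd, show (|d| : ℤ) ^ 4 = (|d| ^ 2) ^ 2 by ring, sq_abs]
  have h4 := octic_apply_four hp hγ hχ hc
  obtain ⟨n₀, n₁, hn, k1, k3, k5, k7⟩ := octic_jacobiSum_four_odd hp hγ hχ
  obtain ⟨m₀, m₁, hm, hm1, k2, k6⟩ := octic_jacobiSum_four_even hp hγ hχ
  have hY := octic_jacobiSum_mul hγ hχ (i := 1) (j := 4) (k := 7) (l := 4)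
    (by norm_num) (by norm_num) (by norm_num) (by norm_num) (by norm_num)
  have hX := octic_jacobiSum_mul hγ hχ (i := 2) (j := 4) (k := 6) (l := 4)
    (by norm_num) (by norm_num) (by norm_num) (by norm_num) (by norm_num)
  have hYn : (p : ℤ) = n₀ ^ 2 + 2 * n₁ ^ 2 := by
    rw [k1, k7] at hY
    have : (p : ℂ) = n₀ ^ 2 + 2 * n₁ ^ 2 := by
      rw [← hY]
      linear_combination n₁ ^ 2 * hs - n₁ ^ 2 * ((√2 : ℝ) : ℂ) ^ 2 * I_sq
    exact_mod_cast this
  have hXn : (p : ℤ) = m₀ ^ 2 + m₁ ^ 2 := by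
    rw [k2, k6] at hX
    have : (p : ℂ) = m₀ ^ 2 + m₁ ^ 2 := by
      rw [← hX]
      linear_combination -m₁ ^ 2 * I_sq
    exact_mod_cast this
  have hn0 : n₀ = 4 - x := by
    have := sq_eq_of_prime_eq_sq_add_two_mul_sq hpp hab hYn
    rcases sq_eq_sq_iff_eq_or_eq_neg.mp this with h | h <;> omega
  have hm0 : m₀ ^ 2 = x ^ 2 := by
    rcases sq_eq_of_prime_eq_sq_add_sq hpp (x := x) (y := 4) (by rw [hx]; norm_num) hXn with h | h
    · exact h.symm
    · exfalso
      rcases sq_eq_sq_iff_eq_or_eq_neg.mp h with h | h <;> omega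
  have hm14 : m₁ = 4 ∨ m₁ = -4 := by
    have : m₁ ^ 2 = 4 ^ 2 := by linarith
    exact sq_eq_sq_iff_eq_or_eq_neg.mp this
  have hm0' : m₀ = -x := by
    rcases sq_eq_sq_iff_eq_or_eq_neg.mp hm0 with h | h <;> omega
  have j22 := octic_jacobiSum_self hp hγ hχ h4 (j := 2) (by norm_num)
  have j66 := octic_jacobiSum_self hp hγ hχ h4 (j := 6) (by norm_num)
  have j11 := octic_jacobiSum_self hp hγ hχ h4 (j := 1) (by norm_num)
  have j33 := octic_jacobiSum_self hp hγ hχ h4 (j := 3) (by norm_num)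
  have j55 := octic_jacobiSum_self hp hγ hχ h4 (j := 5) (by norm_num)
  have j77 := octic_jacobiSum_self hp hγ hχ h4 (j := 7) (by norm_num)
  have j13 := octic_jacobiSum_reflect hp hγ hχ (i := 1) (j := 3) (k := 4)
    (by norm_num) (by norm_num)
  have j57 := octic_jacobiSum_reflect hp hγ hχ (i := 5) (j := 7) (k := 4)
    (by norm_num) (by norm_num)
  have period : ∀ i, χ ^ (i + 8) = χ ^ i := fun i => by
    rw [pow_add, octic_pow_eight hγ hχ, mul_one]
  have c15 := octic_jacobiSum_mul_jacobiSum hγ hχ (i := 1) (j := 5) (k := 4)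
    (by norm_num) (by norm_num) (by norm_num)
  have c37 := octic_jacobiSum_mul_jacobiSum hγ hχ (i := 3) (j := 7) (k := 4)
    (by norm_num) (by norm_num) (by norm_num)
  rw [show 5 + 4 = 1 + 8 from rfl, period 1, j11, show 1 + 5 = 6 from rfl] at c15
  rw [show 7 + 4 = 3 + 8 from rfl, period 3, j33, show 3 + 7 = 2 + 8 from rfl, period 2] at c37
  have hX2 : jacobiSum (χ ^ 2) (χ ^ 4) ≠ 0 := left_ne_zero_of_mul (hX.trans_ne hp0)
  have hX6 : jacobiSum (χ ^ 6) (χ ^ 4) ≠ 0 := right_ne_zero_of_mul (hX.trans_ne hp0)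
  have j15 : jacobiSum (χ ^ 1) (χ ^ 5) = -jacobiSum (χ ^ 2) (χ ^ 4) := by
    refine mul_right_cancel₀ hX6 ?_
    rw [c15, neg_mul, hX, ← hY, k1, k5, k7]
    ring
  have j37 : jacobiSum (χ ^ 3) (χ ^ 7) = -jacobiSum (χ ^ 6) (χ ^ 4) := by
    refine mul_right_cancel₀ hX2 ?_
    rw [c37, neg_mul, mul_comm (jacobiSum (χ ^ 6) _), hX, ← hY, k1, k3, k7]
    ring
  rw [hn0] at k1 k3 k5 k7
  rw [hm0'] at k2 k6
  push_cast at k1 k3 k5 k7 k2 k6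
  refine ⟨m₁, n₁, hm14, ⟨?_, ?_, ?_, ?_⟩, ?_, ?_, ?_, ?_, ?_, ?_⟩
  · rw [j22, k2]; ring
  · rw [j66, k6]; ring
  · rw [j15, k2]; ring
  · rw [j37, k6]; ring
  · rw [j13, k1]
  · rw [j57, k5]
  · rw [j11, k1]; ring
  · rw [j33, k3]; ring
  · rw [j55, k5]; ring
  · rw [j77, k7]; ring

lemma I_pow_val_sub (a b : ZMod 4) : I ^ (a - b).val = I ^ a.val * (-I) ^ b.val := by
  have h2 := I_sq
  have h3 : I ^ 3 = -I := by linear_combination I * I_sq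
  have hv : ∀ c d : ZMod 4, ∃ n : ℕ, c.val + 3 * d.val = (c - d).val + 4 * n := by
    intro c d
    refine ⟨(c.val + 3 * d.val) / 4, ?_⟩
    revert c d
    decide
  obtain ⟨n, hn⟩ := hv a b
  rw [← h3, ← pow_mul, ← pow_add, hn, pow_add, pow_mul, I_pow_four, one_pow, mul_one]

/-- Interpolation of the values of a quaternary sequence by powers of an octic root of unity. -/
lemma quaternary_interpolation (n : ℕ) {v : ZMod 4}
    (h0 : n % 8 = 2 ∨ n % 8 = 6 → v = 0) (h1 : n % 8 = 1 ∨ n % 8 = 3 → v = 1)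
    (h2 : n % 8 = 0 ∨ n % 8 = 4 → v = 2) (h3 : n % 8 = 5 ∨ n % 8 = 7 → v = 3)
    {z : ℂ} (hz : z = zetaEight ^ n) :
    I ^ v.val = -(z ^ 2 + z ^ 6) / 2 + (√2 : ℝ) / 4 * (z + z ^ 3 - z ^ 5 - z ^ 7) ∧
      (-I) ^ v.val = -(z ^ 2 + z ^ 6) / 2 - (√2 : ℝ) / 4 * (z + z ^ 3 - z ^ 5 - z ^ 7) := by
  have hs := ofReal_sqrt_two_sq
  have hw := zetaEight_add
  rw [zetaEight_pow_mod] at hz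
  have hI3 : I ^ 3 = -I := by linear_combination I * I_sq
  suffices h : ∃ e o : ℂ, z ^ 2 + z ^ 6 = e ∧
      z + z ^ 3 - z ^ 5 - z ^ 7 = o * (2 * (I * (√2 : ℝ))) ∧
      I ^ v.val = -e / 2 + o * I ∧ (-I) ^ v.val = -e / 2 - o * I by
    obtain ⟨e, o, he, ho, hp, hm⟩ := h
    rw [he, ho, hp, hm]
    constructor
    · linear_combination -(o * I / 2) * hs
    · linear_combination (o * I / 2) * hs
  have hlt : n % 8 < 8 := Nat.mod_lt _ (by norm_num)
  have hpow : ∀ k, z ^ k = zetaEight ^ (n % 8 * k % 8) := fun k => by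
    rw [hz, ← pow_mul, zetaEight_pow_mod]
  have e1 := hpow 1
  have e2 := hpow 2
  have e3 := hpow 3
  have e5 := hpow 5
  have e6 := hpow 6
  have e7 := hpow 7
  rw [pow_one] at e1
  rw [e2, e3, e5, e6, e7, e1]
  clear e1 e2 e3 e5 e6 e7 hpow hz
  rw [← hw]
  have r2 := zetaEight_sq
  have r3 : zetaEight ^ 3 = zetaEight * I := by rw [← zetaEight_sq]; ring
  have r4 := zetaEight_pow_four
  have r5 : zetaEight ^ 5 = -zetaEight := by linear_combination zetaEight * r4
  have r6 : zetaEight ^ 6 = -I := by linear_combination zetaEight ^ 2 * r4 - zetaEight_sq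
  have r7 : zetaEight ^ 7 = -(zetaEight * I) := by
    linear_combination zetaEight ^ 3 * r4 - r3
  have v1 : (1 : ZMod 4).val = 1 := rfl
  have v2 : (2 : ZMod 4).val = 2 := rfl
  have v3 : (3 : ZMod 4).val = 3 := rfl
  generalize n % 8 = k at *
  interval_cases k
  · rw [h2 (by norm_num), v2]
    refine ⟨2, 0, ?_, ?_, ?_, ?_⟩ <;> norm_num
  · rw [h1 (by norm_num), v1]
    refine ⟨0, 1, ?_, ?_, ?_, ?_⟩ <;> norm_num [r2, r3, r5, r6, r7]
    ring
  · rw [h0 (by norm_num), ZMod.val_zero]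
    refine ⟨-2, 0, ?_, ?_, ?_, ?_⟩ <;> norm_num [r4, r2, r6]
  · rw [h1 (by norm_num), v1]
    refine ⟨0, 1, ?_, ?_, ?_, ?_⟩ <;> norm_num [r2, r3, r5, r6, r7]
    ring
  · rw [h2 (by norm_num), v2]
    refine ⟨2, 0, ?_, ?_, ?_, ?_⟩ <;> norm_num [r4]
  · rw [h3 (by norm_num), v3]
    refine ⟨0, -1, ?_, ?_, ?_, ?_⟩ <;> norm_num [r2, r3, r5, r6, r7, hI3, neg_pow I 3]
    ring
  · rw [h0 (by norm_num), ZMod.val_zero]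
    refine ⟨-2, 0, ?_, ?_, ?_, ?_⟩ <;> norm_num [r4, r2, r6]
  · rw [h3 (by norm_num), v3]
    refine ⟨0, -1, ?_, ?_, ?_, ?_⟩ <;> norm_num [r2, r3, r5, r6, r7, hI3, neg_pow I 3]
    ring

/-- Expansion of a correlation sum with symmetric power moments. -/
lemma sum_interpolation_mul {ι : Type*} (S : Finset ι) (z w : ι → ℂ) (T : ℕ → ℕ → ℂ)
    (hT : ∀ i j, T i j = ∑ t ∈ S, z t ^ i * w t ^ j)
    (hsymm : ∀ i j, i ≠ 0 → j ≠ 0 → T i j = T j i) :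
    ∑ t ∈ S, (-(z t ^ 2 + z t ^ 6) / 2 + (√2 : ℝ) / 4 * (z t + z t ^ 3 - z t ^ 5 - z t ^ 7)) *
      (-(w t ^ 2 + w t ^ 6) / 2 - (√2 : ℝ) / 4 * (w t + w t ^ 3 - w t ^ 5 - w t ^ 7)) =
    (T 2 2 + 2 * T 2 6 + T 6 6) / 4 - (T 1 1 + T 3 3 + T 5 5 + T 7 7 +
      2 * (T 1 3 - T 1 5 - T 1 7 - T 3 5 - T 3 7 + T 5 7)) / 8 := by
  have hs := ofReal_sqrt_two_sq
  have key : ∑ t ∈ S,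
      (-(z t ^ 2 + z t ^ 6) / 2 + (√2 : ℝ) / 4 * (z t + z t ^ 3 - z t ^ 5 - z t ^ 7)) *
      (-(w t ^ 2 + w t ^ 6) / 2 - (√2 : ℝ) / 4 * (w t + w t ^ 3 - w t ^ 5 - w t ^ 7)) =
      1 / 4 * (T 2 2 + T 2 6 + T 6 2 + T 6 6) +
      (√2 : ℝ) / 8 * (T 2 1 + T 2 3 - T 2 5 - T 2 7 + T 6 1 + T 6 3 - T 6 5 - T 6 7) -
      (√2 : ℝ) / 8 * (T 1 2 + T 3 2 - T 5 2 - T 7 2 + T 1 6 + T 3 6 - T 5 6 - T 7 6) -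
      1 / 8 * (T 1 1 + T 1 3 - T 1 5 - T 1 7 + T 3 1 + T 3 3 - T 3 5 - T 3 7 -
        T 5 1 - T 5 3 + T 5 5 + T 5 7 - T 7 1 - T 7 3 + T 7 5 + T 7 7) := by
    simp only [hT, Finset.mul_sum, ← Finset.sum_add_distrib, ← Finset.sum_sub_distrib]
    refine Finset.sum_congr rfl fun t _ => ?_
    linear_combination (-(z t + z t ^ 3 - z t ^ 5 - z t ^ 7) *
      (w t + w t ^ 3 - w t ^ 5 - w t ^ 7) / 16) * hs
  have s (i j : ℕ) (hi : i ≠ 0 := by norm_num) (hj : j ≠ 0 := by norm_num) : T i j = T j i :=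
    hsymm i j hi hj
  rw [key, s 6 2, s 2 1, s 3 2, s 5 2, s 7 2, s 6 1, s 6 3, s 6 5, s 7 6, s 3 1, s 5 1, s 5 3,
    s 7 1, s 7 3, s 7 5]
  ring

lemma eq_of_pow_four_eq_one {v : ℂ} (h : v ^ 4 = 1) : v = 1 ∨ v = -1 ∨ v = I ∨ v = -I := by
  have : (v - 1) * ((v + 1) * ((v - I) * (v + I))) = 0 := by
    linear_combination h - (v ^ 2 - 1) * I_sq
  rcases mul_eq_zero.mp this with h | h
  · exact Or.inl (sub_eq_zero.mp h)
  rcases mul_eq_zero.mp h with h | h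
  · exact Or.inr (Or.inl (eq_neg_of_add_eq_zero_left h))
  rcases mul_eq_zero.mp h with h | h
  · exact Or.inr (Or.inr (Or.inl (sub_eq_zero.mp h)))
  · exact Or.inr (Or.inr (Or.inr (eq_neg_of_add_eq_zero_left h)))

lemma pow_mem_cycCl (hp : p % 16 = 1) {n : ℕ} (hn : n < p - 1) :
    γ ^ n ∈ cycCl p γ 8 (n % 8) :=
  ⟨n / 8, by omega, by rw [Nat.mod_add_div]⟩

lemma octic_sum_mul_shift (hp : p % 16 = 1) (hγ : orderOf γ = p - 1) (hχ : χ γ = zetaEight)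
    {τ : ZMod p} (hτ : τ ≠ 0) {i j : ℕ} (hi : i ≠ 0) (hj : j ≠ 0) :
    ∑ t, χ t ^ i * χ (t + τ) ^ j = χ τ ^ (i + j) * jacobiSum (χ ^ i) (χ ^ j) := by
  have h := sum_mul_shift (χ ^ i) (χ ^ j)
    (by rw [MulChar.pow_apply' _ hi, octic_apply_neg_one hp hγ hχ, one_pow]) hτ
  simpa only [MulChar.pow_apply' _ hi, MulChar.pow_apply' _ hj, ← pow_add] using h

/-- The correlation sum of the interpolating polynomials, evaluated. -/
lemma octic_correlation (hp : p % 16 = 1) (hγ : orderOf γ = p - 1) (hχ : χ γ = zetaEight)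
    {x b : ℤ} (hx : (p : ℤ) = x ^ 2 + 16) (hab : (p : ℤ) = (x - 4) ^ 2 + 2 * b ^ 2)
    (hx4 : x % 4 = 1) {τ : ZMod p} (hτ : τ ≠ 0) :
    -(χ τ ^ 2 + χ τ ^ 6) + ∑ t, (-(χ t ^ 2 + χ t ^ 6) / 2 +
        (√2 : ℝ) / 4 * (χ t + χ t ^ 3 - χ t ^ 5 - χ t ^ 7)) *
      (-(χ (t + τ) ^ 2 + χ (t + τ) ^ 6) / 2 - (√2 : ℝ) / 4 *
        (χ (t + τ) + χ (t + τ) ^ 3 - χ (t + τ) ^ 5 - χ (t + τ) ^ 7)) ∈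
      ({-1, -3, 3} : Set ℂ) := by
  obtain ⟨m, n, hm, ⟨j22, j66, j15, j37⟩, j13, j57, j11, j33, j55, j77⟩ :=
    octic_jacobiSum_table hp hγ hχ hx hab hx4
  have j26 := octic_jacobiSum_inv hp hγ hχ (i := 2) (j := 6) (by norm_num) (by norm_num)
  have j17 := octic_jacobiSum_inv hp hγ hχ (i := 1) (j := 7) (by norm_num) (by norm_num)
  have j35 := octic_jacobiSum_inv hp hγ hχ (i := 3) (j := 5) (by norm_num) (by norm_num)
  have hT (i j : ℕ) (hi : i ≠ 0 := by norm_num) (hj : j ≠ 0 := by norm_num) :=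
    octic_sum_mul_shift hp hγ hχ hτ hi hj
  rw [sum_interpolation_mul Finset.univ (fun t => χ t) (fun t => χ (t + τ))
    (fun i j => ∑ t, χ t ^ i * χ (t + τ) ^ j) (fun _ _ => rfl)
    (fun i j hi hj => by rw [hT i j hi hj, hT j i hj hi, jacobiSum_comm, add_comm]),
    hT 2 2, hT 2 6, hT 6 6, hT 1 1, hT 3 3, hT 5 5, hT 7 7, hT 1 3, hT 1 5, hT 1 7, hT 3 5,
    hT 3 7, hT 5 7, j22, j26, j66, j11, j33, j55, j77, j13, j15, j17, j35, j37, j57]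
  have h8 : χ τ ^ 8 = 1 := by
    rw [← MulChar.pow_apply' _ (by norm_num), octic_pow_eight hγ hχ, MulChar.one_apply hτ.isUnit]
  generalize χ τ = w at h8
  suffices h : -1 - 2 * (w ^ 2) ^ 2 - m * I * ((w ^ 2) ^ 3 - w ^ 2) / 4 ∈ ({-1, -3, 3} : Set ℂ) by
    convert h using 1
    linear_combination (-1 - w ^ 4 * (x + m * I + 4 - x - n * (I * (√2 : ℝ))) / 4 +
      w ^ 2 * (-(x - 4 + n * (I * (√2 : ℝ))) / 8 + (x + m * I) / 4) -
      w ^ 6 * (x - 4 + n * (I * (√2 : ℝ))) / 8) * h8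
  rw [Set.mem_insert_iff, Set.mem_insert_iff, Set.mem_singleton_iff]
  rcases eq_of_pow_four_eq_one (v := w ^ 2) (by rw [← pow_mul, h8]) with h | h | h | h <;> rw [h]
  · right; left; norm_num
  · right; left; norm_num
  · rcases hm with rfl | rfl
    · left
      push_cast
      linear_combination -I ^ 2 * I_sq
    · right; right
      push_cast
      linear_combination (I ^ 2 - 4) * I_sq
  · rcases hm with rfl | rfl
    · right; right
      push_cast
      linear_combination (I ^ 2 - 4) * I_sq
    · left
      push_cast
      linear_combination -I ^ 2 * I_sq

end OcticCharacterModPrime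

theorem stmt1 (p : ℕ) [Fact p.Prime] (hp : p % 16 = 1)
    (x a b : ℤ) (hx : (p : ℤ) = x ^ 2 + 16) (hab : (p : ℤ) = a ^ 2 + 2 * b ^ 2)
    (hx4 : x % 4 = 1) (ha4 : a % 4 = 1) (hxa : x - a = 4)
    (γ : ZMod p) (hγ : orderOf γ = p - 1)
    (u : ZMod p → ZMod 4)
    (hu0 : ∀ t, t ∈ cycCl p γ 8 2 ∪ cycCl p γ 8 6 ∪ {0} → u t = 0)
    (hu1 : ∀ t, t ∈ cycCl p γ 8 1 ∪ cycCl p γ 8 3 → u t = 1)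
    (hu2 : ∀ t, t ∈ cycCl p γ 8 0 ∪ cycCl p γ 8 4 → u t = 2)
    (hu3 : ∀ t, t ∈ cycCl p γ 8 5 ∪ cycCl p γ 8 7 → u t = 3) :
    quatAC u 0 = (p : ℂ) ∧
      ∀ τ : ZMod p, τ ≠ 0 → quatAC u τ ∈ ({-1, -3, 3} : Set ℂ) := by
  obtain ⟨χ, hχ⟩ := exists_mulChar_apply_eq_zetaEight hp hγ
  obtain rfl : a = x - 4 := by omega
  refine ⟨?_, fun τ hτ => ?_⟩
  · simp [quatAC, ZMod.card]
  have hval : ∀ t : ZMod p,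
      Complex.I ^ (u t).val = (if t = 0 then 1 else 0) + (-(χ t ^ 2 + χ t ^ 6) / 2 +
        (√2 : ℝ) / 4 * (χ t + χ t ^ 3 - χ t ^ 5 - χ t ^ 7)) ∧
      (-Complex.I) ^ (u t).val = (if t = 0 then 1 else 0) + (-(χ t ^ 2 + χ t ^ 6) / 2 -
        (√2 : ℝ) / 4 * (χ t + χ t ^ 3 - χ t ^ 5 - χ t ^ 7)) := by
    intro t
    rcases eq_or_ne t 0 with rfl | ht
    · rw [hu0 0 (by simp)]
      simp [MulChar.map_zero]
    · obtain ⟨n, hn, rfl⟩ := exists_eq_pow_of_ne_zero hγ ht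
      have hmem := pow_mem_cycCl (γ := γ) hp hn
      rw [if_neg ht, zero_add, zero_add]
      refine quaternary_interpolation n (fun h => hu0 _ ?_) (fun h => hu1 _ ?_)
        (fun h => hu2 _ ?_) (fun h => hu3 _ ?_) (by rw [map_pow, hχ])
      · rcases h with h | h <;> rw [h] at hmem <;> simp [hmem]
      · rcases h with h | h <;> rw [h] at hmem <;> simp [hmem]
      · rcases h with h | h <;> rw [h] at hmem <;> simp [hmem]
      · rcases h with h | h <;> rw [h] at hmem <;> simp [hmem]
  have hneg : χ (-τ) = χ τ := by
    rw [neg_eq_neg_one_mul, map_mul, octic_apply_neg_one hp hγ hχ, one_mul]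
  convert octic_correlation hp hγ hχ hx hab hx4 hτ using 1
  set F : ZMod p → ℂ := fun t => -(χ t ^ 2 + χ t ^ 6) / 2 +
    (√2 : ℝ) / 4 * (χ t + χ t ^ 3 - χ t ^ 5 - χ t ^ 7) with hF
  set G : ZMod p → ℂ := fun t => -(χ t ^ 2 + χ t ^ 6) / 2 -
    (√2 : ℝ) / 4 * (χ t + χ t ^ 3 - χ t ^ 5 - χ t ^ 7) with hG
  have hFG : -(χ τ ^ 2 + χ τ ^ 6) = G τ + F (-τ) := by
    simp only [hF, hG, hneg]
    ring
  have hterm : ∀ t, Complex.I ^ (u t - u (t + τ)).val =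
      (if t = 0 then G (t + τ) else 0) + (if t = -τ then F t else 0) + F t * G (t + τ) := by
    intro t
    rw [I_pow_val_sub, (hval t).1, (hval (t + τ)).2]
    change (_ + F t) * (_ + G (t + τ)) = _
    have h1 : t + τ = 0 ↔ t = -τ := add_eq_zero_iff_eq_neg
    simp only [h1]
    split_ifs with h h'
    · exact absurd (h.symm.trans h') (neg_ne_zero.mpr hτ).symm
    all_goals ring
  rw [quatAC, Finset.sum_congr rfl fun t _ => hterm t, Finset.sum_add_distrib,
    Finset.sum_add_distrib, hFG]
  simp only [Finset.sum_ite_eq', Finset.mem_univ, if_true, zero_add]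
  rfl
end
end

section
/- Let N be an even positive integer and s₀ : ℤ/Nℤ → ℤ/2ℤ a binary sequence of period N. Define the quaternary sequence u : ℤ/Nℤ → ℤ/4ℤ by u(t) = φ⁻¹(s₀(t), s₀(t + N/2)). Then R_u(τ) = R_{s₀}(τ) for every shift τ ∈ ℤ/Nℤ. -/
open scoped Classical

noncomputable section

lemma I_pow_grayInv_sub (a b c d : ZMod 2) :
    Complex.I ^ (grayInv a b - grayInv c d).val =
      ((-1) ^ (a - c).val + (-1) ^ (b - d).val) / 2 +
        Complex.I * ((-1) ^ (a - d).val - (-1) ^ (b - c).val) / 2 := by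
  have val_two : (2 : ZMod 4).val = 2 := rfl
  have val_three : (3 : ZMod 4).val = 3 := rfl
  have val_neg_two : (-2 : ZMod 4).val = 2 := rfl
  have val_neg_three : (-3 : ZMod 4).val = 1 := rfl
  have one_sub_two : (1 - 2 : ZMod 4) = 3 := rfl
  have one_sub_three : (1 - 3 : ZMod 4) = 2 := rfl
  have two_sub_one : (2 - 1 : ZMod 4) = 1 := rfl
  have two_sub_three : (2 - 3 : ZMod 4) = 3 := rfl
  have three_sub_one : (3 - 1 : ZMod 4) = 2 := rfl
  have three_sub_two : (3 - 2 : ZMod 4) = 1 := rfl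
  have val_one : (1 : ZMod 4).val = 1 := rfl
  have val_one' : (1 : ZMod 2).val = 1 := rfl
  have zero_or_one (x : ZMod 2) : x = 0 ∨ x = 1 := by revert x; decide
  rcases zero_or_one a with rfl | rfl <;> rcases zero_or_one b with rfl | rfl <;>
    rcases zero_or_one c with rfl | rfl <;> rcases zero_or_one d with rfl | rfl <;>
    simp [grayInv, *] <;> ring

theorem stmt9 (N : ℕ) [NeZero N] (hN : 2 ∣ N)
    (s₀ : ZMod N → ZMod 2)
    (u : ZMod N → ZMod 4)
    (hu : ∀ t, u t = grayInv (s₀ t) (s₀ (t + ((N / 2 : ℕ) : ZMod N)))) :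
    ∀ τ : ZMod N, quatAC u τ = (binCC s₀ s₀ τ : ℂ) := by
  intro τ
  set h : ZMod N := ((N / 2 : ℕ) : ZMod N)
  have hh : h + h = 0 := by
    rw [← Nat.cast_add, ← two_mul, Nat.mul_div_cancel' hN, ZMod.natCast_self]
  let X (t : ZMod N) : ℂ := (-1) ^ (s₀ t - s₀ (t + τ)).val
  let Y (t : ZMod N) : ℂ := (-1) ^ (s₀ t - s₀ (t + τ + h)).val
  have key (t : ZMod N) : Complex.I ^ (u t - u (t + τ)).val =
      (X t + X (t + h)) / 2 + Complex.I * (Y t - Y (t + h)) / 2 := by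
    have h₁ : t + h + τ = t + τ + h := by ring
    have h₂ : t + τ + h + h = t + τ := by rw [add_assoc, hh, add_zero]
    simp only [X, Y, hu, I_pow_grayInv_sub, h₁, h₂]
  have shift (f : ZMod N → ℂ) : ∑ t, f (t + h) = ∑ t, f t :=
    Equiv.sum_comp (Equiv.addRight h) f
  have hX : (binCC s₀ s₀ τ : ℂ) = ∑ t, X t := by
    simp [binCC, X]
  simp only [quatAC, key]
  rw [hX, Finset.sum_add_distrib, ← Finset.sum_div, ← Finset.sum_div, ← Finset.mul_sum,
    Finset.sum_add_distrib, Finset.sum_sub_distrib, shift, shift]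
  ring
end
end

section
/- Let N be an even positive integer and s₀ : ℤ/Nℤ → ℤ/2ℤ a binary sequence of period N. Define the quaternary sequence u : ℤ/Nℤ → ℤ/4ℤ by u(t) = φ⁻¹(s₀(t), s₀(t + N/2) + 1), i.e. the second coordinate is the complemented sequence shifted by N/2. Then R_u(τ) = R_{s₀}(τ) for every shift τ ∈ ℤ/Nℤ. -/
open scoped Classical

noncomputable section

/-- The product of two quaternary symbols, in terms of the signs of their binary components
(the second components being complemented). -/
theorem two_mul_I_pow_grayInv_sub (a b c d : ZMod 2) :
    2 * Complex.I ^ (grayInv a (b + 1) - grayInv c (d + 1)).val =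
      (((-1 : ℤ) ^ (a - c).val : ℤ) : ℂ) + (((-1 : ℤ) ^ (b - d).val : ℤ) : ℂ) +
        Complex.I * ((((-1 : ℤ) ^ (b - c).val : ℤ) : ℂ) - (((-1 : ℤ) ^ (a - d).val : ℤ) : ℂ)) := by
  have key : ∀ a b c d : ZMod 2, ((a - c).val, (b - d).val, (b - c).val, (a - d).val,
      (grayInv a (b + 1) - grayInv c (d + 1)).val) ∈
      ([(0, 0, 0, 0, 0), (0, 0, 1, 1, 0), (1, 1, 0, 0, 2), (1, 1, 1, 1, 2),
        (0, 1, 0, 1, 1), (1, 0, 0, 1, 1), (0, 1, 1, 0, 3), (1, 0, 1, 0, 3)] :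
        List (ℕ × ℕ × ℕ × ℕ × ℕ)) := by
    decide
  have h := key a b c d
  simp only [List.mem_cons, Prod.mk.injEq, List.not_mem_nil, or_false] at h
  rcases h with h | h | h | h | h | h | h | h <;> obtain ⟨h₁, h₂, h₃, h₄, h₅⟩ := h <;>
    rw [h₁, h₂, h₃, h₄, h₅] <;> norm_num [pow_succ] <;> ring

/-- Shifting both sequences by the same amount does not change the crosscorrelation. -/
theorem sum_shift_eq_binCC {N : ℕ} [NeZero N] (s₁ s₂ : ZMod N → ZMod 2) (h τ : ZMod N) :
    ∑ t : ZMod N, (-1 : ℤ) ^ (s₁ (t + h) - s₂ (t + τ + h)).val = binCC s₁ s₂ τ := by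
  simp only [add_right_comm _ τ h]
  exact Equiv.sum_comp (Equiv.addRight h) fun t => (-1 : ℤ) ^ (s₁ t - s₂ (t + τ)).val

theorem stmt10 (N : ℕ) [NeZero N] (hN : 2 ∣ N)
    (s₀ : ZMod N → ZMod 2)
    (u : ZMod N → ZMod 4)
    (hu : ∀ t, u t = grayInv (s₀ t) (s₀ (t + ((N / 2 : ℕ) : ZMod N)) + 1)) :
    ∀ τ : ZMod N, quatAC u τ = (binCC s₀ s₀ τ : ℂ) := by
  intro τ
  set h : ZMod N := ((N / 2 : ℕ) : ZMod N) with h_def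
  have hh : h + h = 0 := by
    rw [h_def, ← Nat.cast_add, ← two_mul, Nat.mul_div_cancel' hN, ZMod.natCast_self]
  have hcross : ∑ t : ZMod N, (-1 : ℤ) ^ (s₀ (t + h) - s₀ (t + τ)).val =
      ∑ t : ZMod N, (-1 : ℤ) ^ (s₀ t - s₀ (t + τ + h)).val := by
    have := sum_shift_eq_binCC s₀ s₀ h (τ + h)
    simpa only [binCC, ← add_assoc, add_assoc _ h h, hh, add_zero] using this
  have hdouble : 2 * quatAC u τ = 2 * (binCC s₀ s₀ τ : ℂ) := by
    simp only [quatAC, hu, Finset.mul_sum, two_mul_I_pow_grayInv_sub, Finset.sum_add_distrib]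
    rw [← Finset.mul_sum, Finset.sum_sub_distrib]
    simp only [← Int.cast_sum]
    rw [hcross, sum_shift_eq_binCC, binCC]
    ring
  exact mul_left_cancel₀ two_ne_zero hdouble
end
end

section
/- Let N be an even positive integer and s₀ : ℤ/Nℤ → ℤ/2ℤ a balanced binary sequence of period N whose out-of-phase autocorrelation is optimal, i.e. for all τ ≢ 0 (mod N): R_{s₀}(τ) ∈ {0, −4} if N ≡ 0 (mod 4), and R_{s₀}(τ) ∈ {−2, 2} if N ≡ 2 (mod 4). Let c ∈ ℤ/2ℤ and define the quaternary sequence u : ℤ/Nℤ → ℤ/4ℤ by u(t) = φ⁻¹(s₀(t), s₀(t + N/2) + c). Then u is balanced if N ≡ 0, 2 or 6 (mod 8), and u is almost balanced if N ≡ 4 (mod 8). -/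
open scoped Classical

noncomputable section

/-- The number of `t` at which `s t = a` and `s (t + h) = b`. -/
def pairCount {N : ℕ} [NeZero N] (s : ZMod N → ZMod 2) (h : ZMod N) (a b : ZMod 2) : ℕ :=
  ∑ t : ZMod N, if s t = a ∧ s (t + h) = b then 1 else 0

theorem cnt_eq_sum {N m : ℕ} [NeZero N] (u : ZMod N → ZMod m) (k : ZMod m) :
    cnt u k = ∑ t : ZMod N, if u t = k then 1 else 0 := by
  rw [cnt, Set.ncard_eq_toFinset_card', ← Finset.card_filter]
  congr 1
  ext t
  simp

theorem grayInv_inj : ∀ a b a' b' : ZMod 2, grayInv a b = grayInv a' b' ↔ a = a' ∧ b = b' := by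
  decide

theorem grayInv_surj : ∀ k : ZMod 4, ∃ a b : ZMod 2, grayInv a b = k := by
  decide

section

variable {N : ℕ} [NeZero N] (s : ZMod N → ZMod 2) (h : ZMod N)

theorem exists_cnt_grayInv_eq_pairCount (c : ZMod 2) (k : ZMod 4) :
    ∃ a b, cnt (fun t => grayInv (s t) (s (t + h) + c)) k = pairCount s h a b := by
  obtain ⟨a, b, rfl⟩ := grayInv_surj k
  refine ⟨a, b - c, ?_⟩
  simp only [cnt_eq_sum, pairCount, grayInv_inj, eq_sub_iff_add_eq]

theorem pairCount_add_pairCount_left (a : ZMod 2) :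
    pairCount s h a 0 + pairCount s h a 1 = cnt s a := by
  rw [cnt_eq_sum, pairCount, pairCount, ← Finset.sum_add_distrib]
  refine Finset.sum_congr rfl fun t _ => ?_
  generalize s t = x, s (t + h) = y
  revert a x y
  decide

theorem pairCount_add_pairCount_right (b : ZMod 2) :
    pairCount s h 0 b + pairCount s h 1 b = cnt s b := by
  rw [cnt_eq_sum, ← Equiv.sum_comp (Equiv.addRight h), pairCount, pairCount,
    ← Finset.sum_add_distrib]
  refine Finset.sum_congr rfl fun t _ => ?_
  rw [Equiv.coe_addRight]
  generalize s t = x, s (t + h) = y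
  revert b x y
  decide

theorem cnt_zero_add_cnt_one : cnt s 0 + cnt s 1 = N := by
  rw [cnt_eq_sum, cnt_eq_sum, ← Finset.sum_add_distrib]
  have key : ∀ x : ZMod 2, ((if x = 0 then 1 else 0) + if x = 1 then 1 else 0 : ℕ) = 1 := by
    decide
  simp [key, ZMod.card]

theorem binCC_self_eq_pairCount :
    binCC s s h = pairCount s h 0 0 + pairCount s h 1 1
      - pairCount s h 0 1 - pairCount s h 1 0 := by
  simp only [binCC, pairCount, Nat.cast_sum, ← Finset.sum_add_distrib, ← Finset.sum_sub_distrib]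
  refine Finset.sum_congr rfl fun t _ => ?_
  generalize s t = x, s (t + h) = y
  revert x y
  decide

theorem even_pairCount_self (h0 : h ≠ 0) (h2 : h + h = 0) (a : ZMod 2) :
    Even (pairCount s h a a) := by
  rw [← ZMod.natCast_eq_zero_iff_even, pairCount, Nat.cast_sum]
  refine Finset.sum_involution (fun t _ => t + h) (fun t _ => ?_) (fun t _ _ => ?_)
    (fun t _ => Finset.mem_univ _) (fun t _ => ?_)
  · simp only [add_assoc, h2, add_zero, and_comm]
    exact CharTwo.add_self_eq_zero _
  · simpa using h0
  · rw [add_assoc, h2, add_zero]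

end


theorem stmt12 (N : ℕ) [NeZero N] (hN : 2 ∣ N)
    (s₀ : ZMod N → ZMod 2)
    (hbal : ∀ k₁ k₂ : ZMod 2, cnt s₀ k₁ ≤ cnt s₀ k₂ + 1)
    (hopt0 : N % 4 = 0 → ∀ τ : ZMod N, τ ≠ 0 →
      binCC s₀ s₀ τ = 0 ∨ binCC s₀ s₀ τ = -4)
    (hopt2 : N % 4 = 2 → ∀ τ : ZMod N, τ ≠ 0 →
      binCC s₀ s₀ τ = -2 ∨ binCC s₀ s₀ τ = 2)
    (c : ZMod 2)
    (u : ZMod N → ZMod 4)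
    (hu : ∀ t, u t = grayInv (s₀ t) (s₀ (t + ((N / 2 : ℕ) : ZMod N)) + c)) :
    ((N % 8 = 0 ∨ N % 8 = 2 ∨ N % 8 = 6) →
      ∀ k₁ k₂ : ZMod 4, cnt u k₁ ≤ cnt u k₂ + 1) ∧
    (N % 8 = 4 → ∀ k₁ k₂ : ZMod 4, cnt u k₁ ≤ cnt u k₂ + 2) := by
  obtain rfl : u = _ := funext hu
  have hNpos := Nat.pos_of_neZero N
  set h : ZMod N := ((N / 2 : ℕ) : ZMod N) with hh
  have h0 : h ≠ 0 := by
    rw [hh, Ne, ZMod.natCast_eq_zero_iff]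
    exact Nat.not_dvd_of_pos_of_lt (by omega) (by omega)
  have h2 : h + h = 0 := by
    rw [hh, ← Nat.cast_add, ZMod.natCast_eq_zero_iff]
    exact dvd_of_eq (by omega)
  have hl0 := pairCount_add_pairCount_left s₀ h 0
  have hl1 := pairCount_add_pairCount_left s₀ h 1
  have hr0 := pairCount_add_pairCount_right s₀ h 0
  have hcard := cnt_zero_add_cnt_one s₀
  have hb01 := hbal 0 1
  have hb10 := hbal 1 0
  have hR := binCC_self_eq_pairCount s₀ h
  obtain ⟨m, hm⟩ := even_pairCount_self s₀ h h0 h2 0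
  have hbound : ∀ d : ℕ, (∀ a b a' b', pairCount s₀ h a b ≤ pairCount s₀ h a' b' + d) →
      ∀ k₁ k₂, cnt (fun t => grayInv (s₀ t) (s₀ (t + h) + c)) k₁ ≤
        cnt (fun t => grayInv (s₀ t) (s₀ (t + h) + c)) k₂ + d := by
    intro d hd k₁ k₂
    obtain ⟨a, b, hab⟩ := exists_cnt_grayInv_eq_pairCount s₀ h c k₁
    obtain ⟨a', b', hab'⟩ := exists_cnt_grayInv_eq_pairCount s₀ h c k₂
    rw [hab, hab']
    exact hd a b a' b'
  have hcases : ∀ a b, pairCount s₀ h a b = pairCount s₀ h 0 0 ∨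
      pairCount s₀ h a b = pairCount s₀ h 0 1 := by
    have h11 : pairCount s₀ h 1 1 = pairCount s₀ h 0 0 := by omega
    have h10 : pairCount s₀ h 1 0 = pairCount s₀ h 0 1 := by omega
    intro a b
    fin_cases a <;> fin_cases b
    exacts [.inl rfl, .inr rfl, .inr h10, .inl h11]
  refine ⟨fun hmod => hbound 1 fun a b a' b' => ?_, fun hmod => hbound 2 fun a b a' b' => ?_⟩
  · have := hcases a b
    have := hcases a' b'
    rcases hmod with hmod | hmod
    · have := hopt0 (by omega) h h0
      omega
    · have := hopt2 (by omega) h h0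
      omega
  · have := hcases a b
    have := hcases a' b'
    have := hopt0 (by omega) h h0
    omega
end
end

section
/- Let N be an even positive integer and s : ℤ/Nℤ → ℤ/2ℤ a binary sequence of period N, regarded as a sequence over F₄ via the inclusion F₂ ⊆ F₄. Define v : ℤ/Nℤ → F₄ by v(t) = μ·s(t) + s(t + N/2). Then gcd(X^N − 1, v(X)) = gcd(X^N − 1, s(X)) in F₄[X]; consequently the minimal polynomials coincide, P_v(X) = P_s(X), and L(v) = L(s). -/
open scoped Classical

noncomputable section

/-- The sequence polynomial `v(X) = Σ_{t=0}^{N-1} v(t) X^t` of a sequence `v : ℤ/N → F`. -/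
def seqPoly {N : ℕ} {F : Type*} [Semiring F] (v : ZMod N → F) : Polynomial F :=
  ∑ t ∈ Finset.range N, Polynomial.C (v (t : ZMod N)) * Polynomial.X ^ t

/-- The minimal polynomial `P_v(X) = (X^N - 1) / gcd(X^N - 1, v(X))` of a sequence over a
field (the gcd being taken monic). -/
def minPol {N : ℕ} {F : Type*} [Field F] (v : ZMod N → F) : Polynomial F :=
  (Polynomial.X ^ N - 1) / gcd (Polynomial.X ^ N - 1) (seqPoly v)

/-- The linear complexity `L(v) = N - deg gcd(X^N - 1, v(X))` of a sequence over a field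
(the gcd being taken monic). -/
def linCpx {N : ℕ} {F : Type*} [Field F] (v : ZMod N → F) : ℕ :=
  N - (gcd (Polynomial.X ^ N - 1) (seqPoly v)).natDegree

/-- The inclusion `F₂ ⊆ F` sending `0 ↦ 0`, `1 ↦ 1`. -/
def binToF {F : Type*} [Field F] (x : ZMod 2) : F :=
  if x = 1 then 1 else 0

/-- Multiplying the second argument by an element coprime to the first does not change the gcd. -/
theorem gcd_mul_left_eq_of_isCoprime {R : Type*} [CommRing R] [NormalizedGCDMonoid R]
    {a u : R} (h : IsCoprime a u) (b : R) : gcd a (u * b) = gcd a b := by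
  refine dvd_antisymm_of_normalize_eq (normalize_gcd _ _) (normalize_gcd _ _) ?_ ?_
  · refine dvd_gcd (gcd_dvd_left _ _) ?_
    exact (IsCoprime.of_isCoprime_of_dvd_left h (gcd_dvd_left _ _)).dvd_of_dvd_mul_left (gcd_dvd_right _ _)
  · exact dvd_gcd (gcd_dvd_left _ _) ((gcd_dvd_right _ _).mul_left u)

/-- Shifting a sequence of period `2 * m` by `m` multiplies its sequence polynomial by `X ^ m`
modulo `X ^ (2 * m) - 1`. -/
theorem X_pow_sub_one_dvd_seqPoly_half_shift {F : Type*} [CommRing F] (m : ℕ)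
    (w : ZMod (2 * m) → F) :
    (Polynomial.X ^ (2 * m) - 1 : Polynomial F) ∣
      seqPoly (fun t => w (t + (m : ZMod (2 * m)))) - Polynomial.X ^ m * seqPoly w := by
  have hm : (m : ZMod (2 * m)) + m = 0 := by
    rw [← two_mul]
    exact_mod_cast ZMod.natCast_self (2 * m)
  refine ⟨-∑ t ∈ Finset.range m,
    Polynomial.C (w ((m + t : ℕ) : ZMod (2 * m))) * Polynomial.X ^ t, ?_⟩
  have hsplit (u : ZMod (2 * m) → F) : seqPoly u =
      ∑ t ∈ Finset.range m, Polynomial.C (u (t : ZMod (2 * m))) * Polynomial.X ^ t +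
        Polynomial.X ^ m * ∑ t ∈ Finset.range m,
          Polynomial.C (u ((m + t : ℕ) : ZMod (2 * m))) * Polynomial.X ^ t := by
    unfold seqPoly
    rw [show Finset.range (2 * m) = Finset.range (m + m) by rw [two_mul], Finset.sum_range_add, Finset.mul_sum]
    congr 1
    refine Finset.sum_congr rfl fun t _ => ?_
    ring
  have h₁ (t : ℕ) : (t : ZMod (2 * m)) + m = ((m + t : ℕ) : ZMod (2 * m)) := by
    push_cast
    ring
  have h₂ (t : ℕ) : ((m + t : ℕ) : ZMod (2 * m)) + m = t := by
    push_cast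
    linear_combination hm
  rw [hsplit, hsplit w]
  simp only [h₂]
  simp only [h₁]
  ring

/-- If `μ` is a primitive cube root of unity in characteristic two, then `μ + X ^ m` is coprime
to `X ^ (2 * m) - 1`. -/
theorem isCoprime_X_pow_sub_one_C_add_X_pow {F : Type*} [CommRing F] [CharP F 2] {μ : F}
    (hμ : μ ^ 2 + μ + 1 = 0) (m : ℕ) :
    IsCoprime (Polynomial.X ^ (2 * m) - 1 : Polynomial F)
      (Polynomial.C μ + Polynomial.X ^ m) := by
  have h2 : (2 : Polynomial F) = 0 := CharTwo.two_eq_zero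
  have hC : (Polynomial.C μ) ^ 2 + Polynomial.C μ + 1 = 0 := by
    simpa using congrArg Polynomial.C hμ
  refine ⟨-(Polynomial.C μ + 1),
    (Polynomial.C μ + 1) * (Polynomial.X ^ m - Polynomial.C μ), ?_⟩
  linear_combination (-Polynomial.C μ) * hC + (Polynomial.C μ) * h2

theorem stmt14 (N : ℕ) [NeZero N] (hN : 2 ∣ N)
    (F : Type*) [Field F] [Fintype F] (hF : Fintype.card F = 4)
    (μ : F) (hμ : μ ^ 2 + μ + 1 = 0)
    (s : ZMod N → ZMod 2)
    (v : ZMod N → F)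
    (hv : ∀ t, v t = μ * binToF (s t) + binToF (s (t + ((N / 2 : ℕ) : ZMod N)))) :
    gcd (Polynomial.X ^ N - 1) (seqPoly v) =
        gcd (Polynomial.X ^ N - 1) (seqPoly (fun t => (binToF (s t) : F))) ∧
      minPol v = minPol (fun t => (binToF (s t) : F)) ∧
      linCpx v = linCpx (fun t => (binToF (s t) : F)) := by
  have : CharP F 2 := by
    refine CharTwo.of_one_ne_zero_of_two_eq_zero one_ne_zero (pow_eq_zero_iff two_ne_zero |>.mp ?_)
    have h4 : ((4 : ℕ) : F) = 0 := hF ▸ Nat.cast_card_eq_zero F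
    norm_num at h4 ⊢
    exact h4
  obtain ⟨m, rfl⟩ := hN
  have hm : 2 * m / 2 = m := by omega
  rw [hm] at hv
  set S : ZMod (2 * m) → F := fun t => binToF (s t) with hS
  have hsum : seqPoly v = Polynomial.C μ * seqPoly S +
      seqPoly (fun t => S (t + (m : ZMod (2 * m)))) := by
    simp only [seqPoly, hv, hS, Finset.mul_sum, ← Finset.sum_add_distrib]
    refine Finset.sum_congr rfl fun t _ => ?_
    rw [Polynomial.C_add, Polynomial.C_mul]
    ring
  have hgcd : gcd (Polynomial.X ^ (2 * m) - 1) (seqPoly v) =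
      gcd (Polynomial.X ^ (2 * m) - 1) (seqPoly S) := by
    rw [← gcd_mul_left_eq_of_isCoprime (isCoprime_X_pow_sub_one_C_add_X_pow hμ m) (seqPoly S)]
    refine gcd_eq_of_dvd_sub_right ?_
    convert X_pow_sub_one_dvd_seqPoly_half_shift m S using 1
    rw [hsum]
    ring
  exact ⟨hgcd, by rw [minPol, minPol, hgcd], by rw [linCpx, linCpx, hgcd]⟩
end
end

section
/- Let p ≡ 1 (mod 8) be a prime, let D_0, D_1, D_2, D_3 be the cyclotomic classes of order 4 modulo p, and set C_0 = D_1 ∪ D_2 and C_1 = D_2 ∪ D_3 ∪ {0}. Then the crosscorrelations of the characteristic sequences of C_0 and C_1 are symmetric: R_{s_{C_0}, s_{C_1}}(τ) = R_{s_{C_1}, s_{C_0}}(τ) for every shift τ ∈ ℤ/pℤ. -/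
open scoped Classical

noncomputable section

theorem neg_one_eq_pow_of_orderOf {p m : ℕ} [Fact p.Prime] (hm : 0 < m) {γ : ZMod p}
    (hγ : orderOf γ = 2 * m) : γ ^ m = -1 := by
  have hsq : γ ^ m * γ ^ m = 1 := by
    rw [← pow_add, ← two_mul, ← hγ, pow_orderOf_eq_one]
  refine (mul_self_eq_one_iff.mp hsq).resolve_left fun h => ?_
  have hle := Nat.le_of_dvd hm (orderOf_dvd_of_pow_eq_one h)
  omega

theorem neg_mem_cycCl {p : ℕ} [Fact p.Prime] (hp : p % 8 = 1) {γ : ZMod p}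
    (hγ : orderOf γ = p - 1) {k : ℕ} {x : ZMod p} (hx : x ∈ cycCl p γ 4 k) :
    -x ∈ cycCl p γ 4 k := by
  obtain ⟨j, hj, rfl⟩ := hx
  obtain ⟨m, hm⟩ : ∃ m, p = 8 * m + 1 := ⟨p / 8, by omega⟩
  have hneg : γ ^ (4 * m) = -1 := neg_one_eq_pow_of_orderOf (by omega) (by omega)
  rcases lt_or_ge j m with h | h
  · refine ⟨j + m, by omega, ?_⟩
    rw [mul_add, ← add_assoc, pow_add _ _ (4 * m), hneg, mul_neg_one]
  · refine ⟨j - m, by omega, ?_⟩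
    have hexp : k + 4 * j = k + 4 * (j - m) + 4 * m := by omega
    rw [hexp, pow_add _ _ (4 * m), hneg, mul_neg_one, neg_neg]

theorem neg_mem_cycCl_iff {p : ℕ} [Fact p.Prime] (hp : p % 8 = 1) {γ : ZMod p}
    (hγ : orderOf γ = p - 1) {k : ℕ} {x : ZMod p} :
    -x ∈ cycCl p γ 4 k ↔ x ∈ cycCl p γ 4 k :=
  ⟨fun h => neg_neg x ▸ neg_mem_cycCl hp hγ h, neg_mem_cycCl hp hγ⟩

/-- Crosscorrelation of even sequences is symmetric. -/
theorem binCC_comm_of_even {N : ℕ} [NeZero N] {s₁ s₂ : ZMod N → ZMod 2}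
    (h₁ : ∀ t, s₁ (-t) = s₁ t) (h₂ : ∀ t, s₂ (-t) = s₂ t) (τ : ZMod N) :
    binCC s₁ s₂ τ = binCC s₂ s₁ τ := by
  have hsub : ∀ a b : ZMod 2, a - b = b - a := by decide
  refine Fintype.sum_equiv (Equiv.neg _ |>.trans (Equiv.subRight τ)) _ _ fun t => ?_
  have hshift : -t - τ = -(t + τ) := by ring
  simp only [Equiv.trans_apply, Equiv.neg_apply, Equiv.subRight_apply, sub_add_cancel, h₁]
  rw [hshift, h₂, hsub]

theorem stmt16 (p : ℕ) [Fact p.Prime] (hp : p % 8 = 1)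
    (γ : ZMod p) (hγ : orderOf γ = p - 1) :
    ∀ τ : ZMod p,
      binCC (charSeq (cycCl p γ 4 1 ∪ cycCl p γ 4 2))
          (charSeq (cycCl p γ 4 2 ∪ cycCl p γ 4 3 ∪ {0})) τ =
        binCC (charSeq (cycCl p γ 4 2 ∪ cycCl p γ 4 3 ∪ {0}))
          (charSeq (cycCl p γ 4 1 ∪ cycCl p γ 4 2)) τ := by
  refine binCC_comm_of_even (fun t => ?_) (fun t => ?_) <;>
    simp only [charSeq, Set.mem_union, Set.mem_singleton_iff, neg_eq_zero,
      neg_mem_cycCl_iff hp hγ]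
end
end
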